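/- arXiv:1304.4632 — 8 statements merged into one kernel-verified Lean document; each statement's English description precedes it below -/
import Mathlib

section
/- Let G be a finitely presented group, given by a surjection π from the free group F on x_1,…,x_n onto G with kernel the normal closure of relations r_1,…,r_m. Let z be a central element of G of order d (where d = 0 signifies infinite order), and let N be the cyclic subgroup generated by z. Let φ be an endomorphism of G/N, and fix representatives x̄_1,…,x̄_n ∈ G with x̄_i N = φ(π(x_i) N) and integers w_1,…,w_m with r_k(x̄_1,…,x̄_n) = z^{-w_k}. Let m_{kj} be the exponent sum of x_j in r_k. Then the set of lifts of φ to endomorphisms of G is in bijection with the set of solutions v = (v_1,…,v_n) ∈ (ℤ/dℤ)^n of the system of congruences ∑_{j=1}^n m_{kj} v_j ≡ w_k (mod d) for k = 1,…,m; the lift corresponding to v sends π(x_i) to x̄_i z^{v_i}. -/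
theorem aux_word {n : ℕ} {G : Type*} [Group G] (z : G) (hz : z ∈ Subgroup.center G)
    (xbar : Fin n → G) (c : Fin n → ℤ) (x : FreeGroup (Fin n)) :
    FreeGroup.lift (fun i => xbar i * z ^ c i) x = FreeGroup.lift xbar x *
      z ^ (∑ j, Multiplicative.toAdd
        (FreeGroup.lift
          (fun i => Multiplicative.ofAdd (if i = j then (1 : ℤ) else 0)) x) * c j) := by
  have hc : ∀ (a : ℤ) (g : G), g * z ^ a = z ^ a * g := fun a g =>
    Subgroup.mem_center_iff.1 (Subgroup.zpow_mem _ hz a) g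
  induction x using FreeGroup.induction_on with
  | C1 => simp
  | of i => simp
  | inv_of i _ =>
    simp only [map_inv, FreeGroup.lift_apply_of, toAdd_inv, toAdd_ofAdd, mul_inv_rev]
    simp [hc, ← zpow_neg]
  | mul x y hx hy =>
    simp only [map_mul, hx, hy, toAdd_mul, add_mul, Finset.sum_add_distrib, zpow_add]
    rw [mul_assoc, mul_assoc, ← mul_assoc (z ^ _) (FreeGroup.lift xbar y), ← hc]
    simp only [mul_assoc]

/-- Let `G` be finitely presented via `π : F ↠ G` with kernel the normal
closure of relations `r_1, …, r_m`.  Let `z` be a central element of order `d` (with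
`d = 0` meaning infinite order) and `N = ⟨z⟩`.  Let `φ` be an endomorphism of `G/N`, fix
representatives `x̄_i` with `x̄_i N = φ (π x_i · N)` and integers `w_k` with
`r_k(x̄) = z^{-w_k}`, and let `M k j` be the exponent sum of `x_j` in `r_k`.  Then the
lifts of `φ` to endomorphisms of `G` are in bijection with the solutions
`v ∈ (ℤ/dℤ)ⁿ` of `∑ j, M k j * v j ≡ w k (mod d)` for all `k`; the lift corresponding to
`v` sends `π x_i` to `x̄_i z^{v_i}`. -/
theorem lifts_biject_with_matrix_solutions
    {n m : ℕ} {G : Type*} [Group G]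
    (π : FreeGroup (Fin n) →* G) (hπ : Function.Surjective π)
    (r : Fin m → FreeGroup (Fin n))
    (hker : π.ker = Subgroup.normalClosure (Set.range r))
    (z : G) (hz : z ∈ Subgroup.center G)
    (d : ℕ) (hd : orderOf z = d)
    [(Subgroup.zpowers z).Normal]
    (φ : (G ⧸ Subgroup.zpowers z) →* (G ⧸ Subgroup.zpowers z))
    (xbar : Fin n → G)
    (hxbar : ∀ i : Fin n,
      ((xbar i : G) : G ⧸ Subgroup.zpowers z) = φ ((π (FreeGroup.of i) : G ⧸ Subgroup.zpowers z)))
    (w : Fin m → ℤ)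
    (hw : ∀ k : Fin m, FreeGroup.lift xbar (r k) = z ^ (-(w k)))
    (M : Fin m → Fin n → ℤ)
    (hM : ∀ k j, M k j =
      Multiplicative.toAdd
        (FreeGroup.lift
          (fun i => Multiplicative.ofAdd (if i = j then (1 : ℤ) else 0)) (r k))) :
    ∃ e : {v : Fin n → ZMod d // ∀ k : Fin m, ∑ j : Fin n, (M k j : ZMod d) * v j = (w k : ZMod d)} ≃
          {ψ : G →* G // ∀ g : G,
            ((ψ g : G) : G ⧸ Subgroup.zpowers z) = φ ((g : G ⧸ Subgroup.zpowers z))},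
      ∀ v, ∀ i : Fin n, ∀ c : ℤ, (c : ZMod d) = v.1 i →
        (e v).1 (π (FreeGroup.of i)) = xbar i * z ^ c := by
  have hzz : ∀ a b : ℤ, z ^ a = z ^ b ↔ (a : ZMod d) = (b : ZMod d) := by
    intro a b
    rw [zpow_eq_zpow_iff_modEq, hd, ZMod.intCast_eq_intCast_iff]
  have hrel : ∀ c : Fin n → ℤ, ∀ k, FreeGroup.lift (fun i => xbar i * z ^ c i) (r k) = 1 ↔
      ∑ j : Fin n, (M k j : ZMod d) * (c j : ZMod d) = (w k : ZMod d) := by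
    intro c k
    rw [aux_word z hz, hw, zpow_neg, inv_mul_eq_one, hzz]
    simp only [← hM]
    push_cast
    exact eq_comm
  have hext : ∀ ψ₁ ψ₂ : G →* G,
      (∀ i, ψ₁ (π (FreeGroup.of i)) = ψ₂ (π (FreeGroup.of i))) → ψ₁ = ψ₂ := by
    intro ψ₁ ψ₂ h
    have h2 : ψ₁.comp π = ψ₂.comp π := FreeGroup.ext_hom _ _ h
    ext g
    obtain ⟨x, rfl⟩ := hπ g
    exact DFunLike.congr_fun h2 x
  have hex : ∀ v : {v : Fin n → ZMod d // ∀ k : Fin m,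
      ∑ j : Fin n, (M k j : ZMod d) * v j = (w k : ZMod d)},
      ∃ ψ : {ψ : G →* G // ∀ g : G,
            ((ψ g : G) : G ⧸ Subgroup.zpowers z) = φ ((g : G ⧸ Subgroup.zpowers z))},
        ∀ i : Fin n, ∀ c : ℤ, (c : ZMod d) = v.1 i →
        ψ.1 (π (FreeGroup.of i)) = xbar i * z ^ c := by
    rintro ⟨v, hv⟩
    choose c hcv using fun i => ZMod.intCast_surjective (v i)
    have hle : π.ker ≤ (FreeGroup.lift (fun i => xbar i * z ^ c i)).ker := by
      rw [hker]
      apply Subgroup.normalClosure_le_normal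
      rintro _ ⟨k, rfl⟩
      have := (hrel c k).2 (by simpa only [hcv] using hv k)
      exact this
    let ψ : G →* G := π.liftOfSurjective hπ ⟨FreeGroup.lift (fun i => xbar i * z ^ c i), hle⟩
    have hψ : ∀ x, ψ (π x) = FreeGroup.lift (fun i => xbar i * z ^ c i) x := fun x =>
      MonoidHom.liftOfRightInverse_comp_apply π _ _ _ x
    refine ⟨⟨ψ, ?_⟩, ?_⟩
    · intro g
      obtain ⟨x, rfl⟩ := hπ g
      have h2 : ((QuotientGroup.mk' (Subgroup.zpowers z)).comp ψ).comp π
          = (φ.comp (QuotientGroup.mk' (Subgroup.zpowers z))).comp π := by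
        apply FreeGroup.ext_hom
        intro i
        change ((ψ (π (FreeGroup.of i)) : G) : G ⧸ Subgroup.zpowers z)
          = φ ((π (FreeGroup.of i) : G ⧸ Subgroup.zpowers z))
        rw [hψ, FreeGroup.lift_apply_of, ← hxbar]
        exact QuotientGroup.mk_mul_of_mem _ (Subgroup.zpow_mem_zpowers z _)
      exact DFunLike.congr_fun h2 x
    · intro i a ha
      change ψ _ = _
      rw [hψ, FreeGroup.lift_apply_of, (hzz a (c i)).2 (by rw [ha, hcv])]
  choose f hf using hex
  refine ⟨Equiv.ofBijective f ⟨?_, ?_⟩, hf⟩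
  · intro v₁ v₂ h
    ext i
    obtain ⟨a, ha⟩ := ZMod.intCast_surjective (v₁.1 i)
    obtain ⟨b, hb⟩ := ZMod.intCast_surjective (v₂.1 i)
    have h1 := hf v₁ i a ha
    rw [h, hf v₂ i b hb] at h1
    rw [← ha, ← hb]
    exact ((hzz _ _).1 (mul_left_cancel h1)).symm
  · rintro ⟨ψ, hψ⟩
    have : ∀ i, ∃ c : ℤ, ψ (π (FreeGroup.of i)) = xbar i * z ^ c := by
      intro i
      have h := (hxbar i).trans (hψ (π (FreeGroup.of i))).symm
      obtain ⟨c, hc⟩ := Subgroup.mem_zpowers_iff.1 (QuotientGroup.eq.1 h)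
      exact ⟨c, by rw [hc]; group⟩
    choose c hc using this
    have hcomp : ψ.comp π = FreeGroup.lift (fun i => xbar i * z ^ c i) := by
      apply FreeGroup.ext_hom
      intro i
      simp [hc]
    have hk : ∀ k, π (r k) = 1 := by
      intro k
      have : r k ∈ π.ker := by
        rw [hker]
        exact Subgroup.subset_normalClosure ⟨k, rfl⟩
      exact this
    refine ⟨⟨fun i => (c i : ZMod d), fun k => (hrel c k).1 ?_⟩, ?_⟩
    · rw [← hcomp, MonoidHom.comp_apply, hk, map_one]
    · apply Subtype.ext
      apply hext
      intro i
      rw [hf _ i (c i) rfl, hc]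
end

section
/- Let G be a group, N a finitely generated central subgroup of G, φ an automorphism of G/N, and ψ an endomorphism of G that is a lift of φ. Then ψ is an automorphism of G if and only if ψ(N) = N. -/
/-- Let `N` be a finitely generated central subgroup of `G`, `φ` an
automorphism of `G/N`, and `ψ` an endomorphism of `G` lifting `φ`.  Then `ψ` is an
automorphism of `G` if and only if `ψ(N) = N`. -/
theorem lift_is_automorphism_iff_maps_N_onto_N
    {G : Type*} [Group G]
    (N : Subgroup G) [N.Normal] (hN : N ≤ Subgroup.center G) (hfg : N.FG)
    (φ : MulAut (G ⧸ N)) (ψ : G →* G)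
    (hlift : ∀ g : G, ((ψ g : G) : G ⧸ N) = φ ((g : G ⧸ N))) :
    Function.Bijective ψ ↔ N.map ψ = N := by
  have key : ∀ g : G, ψ g ∈ N ↔ g ∈ N := by
    intro g
    rw [← QuotientGroup.eq_one_iff, ← QuotientGroup.eq_one_iff (N := N) g, hlift]
    exact map_eq_one_iff φ φ.injective
  constructor
  · intro hb
    ext x
    constructor
    · rintro ⟨n, hn, rfl⟩
      exact (key n).2 hn
    · intro hx
      obtain ⟨y, rfl⟩ := hb.2 x
      exact ⟨y, (key y).1 hx, rfl⟩
  · intro hmap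
    constructor
    · rw [injective_iff_map_eq_one]
      intro g hg
      have hgN : g ∈ N := (key g).1 (hg ▸ N.one_mem)
      letI : CommGroup N :=
        { (inferInstance : Group N) with
          mul_comm := fun a b => Subtype.ext ((Subgroup.mem_center_iff.1 (hN b.2)) a) }
      haveI : Group.FG N := (Group.fg_iff_subgroup_fg N).2 hfg
      haveI : Module.Finite ℤ (Additive N) :=
        Module.Finite.iff_addGroup_fg.2 inferInstance
      let f : N →* N :=
        { toFun := fun n => ⟨ψ n, (key n).2 n.2⟩
          map_one' := Subtype.ext (map_one ψ)
          map_mul' := fun a b => Subtype.ext (map_mul ψ (a : G) (b : G)) }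
      let F : Additive N →ₗ[ℤ] Additive N := (MonoidHom.toAdditive f).toIntLinearMap
      have hs : Function.Surjective F := by
        intro x
        obtain ⟨n, hn, h⟩ : (x.toMul : G) ∈ N.map ψ := hmap.symm ▸ x.toMul.2
        exact ⟨Additive.ofMul ⟨n, hn⟩, Subtype.ext h⟩
      have hi := OrzechProperty.injective_of_surjective_endomorphism F hs
      have h1 : F (Additive.ofMul ⟨g, hgN⟩) = F (Additive.ofMul 1) :=
        Subtype.ext (hg.trans (map_one ψ).symm)
      exact congrArg Subtype.val (hi h1)
    · intro g
      obtain ⟨q, hq⟩ := φ.surjective (g : G ⧸ N)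
      obtain ⟨h, rfl⟩ := QuotientGroup.mk_surjective q
      rw [← hlift, QuotientGroup.eq] at hq
      obtain ⟨n, -, hn⟩ : (ψ h)⁻¹ * g ∈ N.map ψ := hmap.symm ▸ hq
      exact ⟨h * n, by rw [map_mul, hn, mul_inv_cancel_left]⟩
end

section
/- Let G be a group and N a finite central subgroup of G whose order is squarefree. Let φ be an automorphism of G/N and let ψ be an endomorphism of G that is a lift of φ. Then G is the internal direct product of K := Ker(ψ) and H := Im(ψ); that is, K and H are normal in G, K ∩ H = {1}, and K·H = G. -/
/-- Let `N` be a finite central subgroup of `G` of squarefree order,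
`φ` an automorphism of `G/N`, and `ψ` an endomorphism of `G` lifting `φ`.  Then `G` is
the internal direct product of `K = ker ψ` and `H = Im ψ`: both are normal, they
intersect trivially, and together they generate `G`. -/
theorem internal_direct_product_of_lift
    {G : Type*} [Group G]
    (N : Subgroup G) [N.Normal] (hN : N ≤ Subgroup.center G)
    [Finite N] (hsf : Squarefree (Nat.card N))
    (φ : MulAut (G ⧸ N)) (ψ : G →* G)
    (hlift : ∀ g : G, ((ψ g : G) : G ⧸ N) = φ ((g : G ⧸ N))) :
    ψ.ker.Normal ∧ ψ.range.Normal ∧ ψ.ker ⊓ ψ.range = ⊥ ∧ ψ.ker ⊔ ψ.range = ⊤ := by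
  have hmem : ∀ g : G, ψ g ∈ N ↔ g ∈ N := by
    intro g
    rw [← QuotientGroup.eq_one_iff, ← QuotientGroup.eq_one_iff, hlift g]
    exact map_eq_one_iff φ φ.injective
  have hkN : ψ.ker ≤ N := by
    intro g hg
    rw [← hmem g, MonoidHom.mem_ker.1 hg]
    exact N.one_mem
  let f : N →* N := (ψ.comp N.subtype).codRestrict N (fun x => (hmem x).2 x.2)
  have hf : ∀ x : N, ((f x : N) : G) = ψ x := fun _ => rfl
  have hcard : Nat.card f.ker * Nat.card f.range = Nat.card N := by
    rw [← f.ker.card_mul_index, Subgroup.index_ker]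
  have hcop : (Nat.card f.ker).Coprime (Nat.card f.range) :=
    Nat.coprime_of_squarefree_mul (hcard ▸ hsf)
  have hcomp := Subgroup.isComplement'_of_coprime hcard hcop
  have hNle : N ≤ ψ.ker ⊔ ψ.range := by
    intro n hn
    have h : (⟨n, hn⟩ : N) ∈ f.ker ⊔ f.range := by rw [hcomp.sup_eq_top]; trivial
    obtain ⟨k, hk, y, ⟨x, rfl⟩, hy⟩ := Subgroup.mem_sup_of_normal_left.1 h
    have e : (k : G) * ψ x = n := congrArg Subtype.val hy
    rw [← e]
    refine Subgroup.mul_mem_sup ?_ ⟨_, rfl⟩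
    have := congrArg Subtype.val (MonoidHom.mem_ker.1 hk)
    exact this
  have hdec : ∀ g : G, ∃ x : G, g * (ψ x)⁻¹ ∈ N := by
    intro g
    obtain ⟨x, hx⟩ := QuotientGroup.mk_surjective (φ.symm (g : G ⧸ N))
    refine ⟨x, ?_⟩
    rw [← QuotientGroup.eq_one_iff, QuotientGroup.mk_mul, QuotientGroup.mk_inv, hlift, hx]
    simp
  refine ⟨inferInstance, ⟨?_⟩, ?_, ?_⟩
  · rintro _ ⟨y, rfl⟩ g
    obtain ⟨x, hx⟩ := hdec g
    have hc := Subgroup.mem_center_iff.1 (hN hx) (ψ (x * y * x⁻¹))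
    refine ⟨x * y * x⁻¹, ?_⟩
    have : g * ψ y * g⁻¹ = (g * (ψ x)⁻¹) * ψ (x * y * x⁻¹) * (g * (ψ x)⁻¹)⁻¹ := by
      simp only [map_mul, map_inv]; group
    rw [this, ← hc]; group
  · rw [eq_bot_iff]
    rintro _ ⟨hk, x, rfl⟩
    have hx : x ∈ N := (hmem x).1 (hkN hk)
    have h : f ⟨x, hx⟩ ∈ f.ker ⊓ f.range :=
      ⟨Subtype.ext hk, ⟨_, rfl⟩⟩
    rw [hcomp.disjoint.eq_bot, Subgroup.mem_bot] at h
    exact congrArg Subtype.val h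
  · rw [eq_top_iff]
    intro g _
    obtain ⟨x, hx⟩ := hdec g
    have := mul_mem (hNle hx) ((le_sup_right : ψ.range ≤ ψ.ker ⊔ ψ.range) ⟨x, rfl⟩)
    simpa using this
end

section
/- Let G be a group and N a finite central subgroup of G whose order is squarefree, and let φ be an automorphism of G/N. Then φ has a lift to an endomorphism of G if and only if φ has a lift to an automorphism of G. -/
/-- Let `N` be a finite central subgroup of `G` of squarefree order and
`φ` an automorphism of `G/N`.  Then `φ` lifts to an endomorphism of `G` if and only if it
lifts to an automorphism of `G`. -/
theorem lifts_to_endo_iff_lifts_to_auto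
    {G : Type*} [Group G]
    (N : Subgroup G) [N.Normal] (hN : N ≤ Subgroup.center G)
    [Finite N] (hsf : Squarefree (Nat.card N))
    (φ : MulAut (G ⧸ N)) :
    (∃ ψ : G →* G, ∀ g : G, ((ψ g : G) : G ⧸ N) = φ ((g : G ⧸ N))) ↔
      (∃ ψ' : MulAut G, ∀ g : G, ((ψ' g : G) : G ⧸ N) = φ ((g : G ⧸ N))) := by
  constructor
  swap
  · rintro ⟨ψ, h⟩
    exact ⟨ψ.toMonoidHom, h⟩
  rintro ⟨ψ, h⟩
  have hmem : ∀ g, ψ g ∈ N ↔ g ∈ N := by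
    intro g
    rw [← QuotientGroup.eq_one_iff, h, map_eq_one_iff φ φ.injective, QuotientGroup.eq_one_iff]
  have hker : ∀ g, ψ g = 1 → g ∈ N := fun g hg => (hmem g).1 (hg ▸ N.one_mem)
  let f : N →* N := (ψ.comp N.subtype).codRestrict N (fun x => (hmem _).2 x.2)
  have hf : ∀ x : N, ((f x : N) : G) = ψ x := fun x => rfl
  have hcard : Nat.card f.range * Nat.card f.ker = Nat.card N := by
    rw [← Subgroup.index_ker, mul_comm, Subgroup.card_mul_index]
  have hco : (Nat.card f.range).Coprime (Nat.card f.ker) := by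
    rw [← hcard] at hsf
    exact Nat.coprime_of_squarefree_mul hsf
  have hc : Subgroup.IsComplement' f.range f.ker := Subgroup.isComplement'_of_coprime hcard hco
  have hdisj : ∀ x, x ∈ ψ.range → ψ x = 1 → x = 1 := by
    rintro _ ⟨g, rfl⟩ hx
    have hg : g ∈ N := (hmem g).1 (hker _ hx)
    have h1 : f ⟨g, hg⟩ ∈ f.range ⊓ f.ker := ⟨⟨_, rfl⟩, Subtype.ext hx⟩
    rw [hc.disjoint.eq_bot, Subgroup.mem_bot] at h1
    exact congrArg Subtype.val h1
  let m : ψ.range × ψ.ker →* G := MonoidHom.noncommCoprod ψ.range.subtype ψ.ker.subtype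
    (fun a b => ((Subgroup.mem_center_iff.1 (hN (hker b b.2)) a)))
  have hm : ∀ a b, m (a, b) = a * b := fun a b => rfl
  have hmb : Function.Bijective m := by
    constructor
    · rw [injective_iff_map_eq_one]
      rintro ⟨a, b⟩ hab
      rw [hm] at hab
      have ha : (a : G) = (b : G)⁻¹ := eq_inv_of_mul_eq_one_left hab
      have ha1 : (a : G) = 1 := hdisj a a.2 (by rw [ha, map_inv, b.2, inv_one])
      have hb1 : (b : G) = 1 := by simpa [ha1] using hab
      exact Prod.ext (Subtype.ext ha1) (Subtype.ext hb1)
    · intro g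
      obtain ⟨q, hq⟩ := φ.surjective (g : G ⧸ N)
      obtain ⟨y, rfl⟩ := QuotientGroup.mk_surjective q
      rw [← h, QuotientGroup.eq] at hq
      obtain ⟨⟨⟨_, ⟨r, rfl⟩⟩, ⟨k, hk⟩⟩, hrk⟩ := hc.2 ⟨_, hq⟩
      have hrk' : ψ r * (k : G) = (ψ y)⁻¹ * g := congrArg Subtype.val hrk
      have hk' : ψ (k : G) = 1 := congrArg Subtype.val hk
      refine ⟨(⟨ψ (y * r), ⟨_, rfl⟩⟩, ⟨k, hk'⟩), ?_⟩
      rw [hm]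
      simp only [map_mul]
      rw [mul_assoc, hrk', mul_inv_cancel_left]
  let e := MulEquiv.ofBijective m hmb
  have he : ∀ a b, e (a, b) = a * b := fun a b => rfl
  let θ : G →* ψ.range × ψ.ker :=
    ψ.rangeRestrict.prod ((MonoidHom.snd _ _).comp e.symm.toMonoidHom)
  have hθ : ∀ g, θ g = (⟨ψ g, ⟨g, rfl⟩⟩, (e.symm g).2) := fun g => rfl
  have hek : ∀ k : ψ.ker, e.symm (k : G) = (1, k) := by
    intro k
    rw [MulEquiv.symm_apply_eq, he]; simp
  have hθk : ∀ k : ψ.ker, θ (k : G) = (1, k) := by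
    intro k
    rw [hθ, hek]
    exact Prod.ext (Subtype.ext k.2) rfl
  have hθb : Function.Bijective θ := by
    constructor
    · rw [injective_iff_map_eq_one]
      intro g hg
      have h1 : ψ g = 1 := congrArg (fun p => (p.1 : G)) hg
      have h2 := hθk ⟨g, h1⟩
      rw [show θ ((⟨g, h1⟩ : ψ.ker) : G) = 1 from hg] at h2
      exact (congrArg (fun p => (p.2 : G)) h2).symm
    · rintro ⟨⟨_, ⟨g, rfl⟩⟩, k⟩
      refine ⟨g * (((e.symm g).2⁻¹ * k : ψ.ker) : G), ?_⟩
      rw [map_mul, hθk, hθ]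
      simp
  refine ⟨(MulEquiv.ofBijective θ hθb).trans e, fun g => ?_⟩
  rw [← h]
  change ((e (θ g) : G) : G ⧸ N) = _
  rw [hθ, he, eq_comm, QuotientGroup.eq]
  simpa using hker _ (e.symm g).2.2
end

section
/- Let G be a group, let z be a central element of G of order p^k for a prime p and k ≥ 1, and let N be the cyclic subgroup generated by z. Let φ be an automorphism of G/N and let ψ be an endomorphism of G that is a lift of φ. Then ψ is an automorphism of G if and only if ψ(z)^{p^{k-1}} ≠ 1. -/
/-- Let `z` be a central element of `G` of order `p^k` (`p` prime,
`k ≥ 1`) and `N = ⟨z⟩`.  Let `φ` be an automorphism of `G/N` and `ψ` an endomorphism of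
`G` lifting `φ`.  Then `ψ` is an automorphism of `G` iff `ψ(z)^{p^{k-1}} ≠ 1`. -/
theorem lift_is_automorphism_iff_pow_ne_one
    {G : Type*} [Group G]
    (z : G) (hz : z ∈ Subgroup.center G)
    (p k : ℕ) (hp : p.Prime) (hk : 1 ≤ k) (hord : orderOf z = p ^ k)
    [(Subgroup.zpowers z).Normal]
    (φ : MulAut (G ⧸ Subgroup.zpowers z)) (ψ : G →* G)
    (hlift : ∀ g : G,
      ((ψ g : G) : G ⧸ Subgroup.zpowers z) = φ ((g : G ⧸ Subgroup.zpowers z))) :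
    Function.Bijective ψ ↔ (ψ z) ^ (p ^ (k - 1)) ≠ 1 := by
  haveI := Fact.mk hp
  obtain ⟨m, rfl⟩ : ∃ m, k = m + 1 := ⟨k - 1, by omega⟩
  simp only [Nat.add_sub_cancel]
  constructor
  · intro hb h
    rw [← map_pow] at h
    have h1 : z ^ p ^ m = 1 := hb.1 (h.trans (map_one ψ).symm)
    have h2 := orderOf_dvd_of_pow_eq_one h1
    rw [hord] at h2
    have h3 := (Nat.pow_dvd_pow_iff_le_right hp.one_lt).1 h2
    omega
  · intro h
    have ho : orderOf (ψ z) = p ^ (m + 1) := by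
      apply orderOf_eq_prime_pow h
      rw [← map_pow, ← hord, pow_orderOf_eq_one, map_one]
    have hzN : ((z : G) : G ⧸ Subgroup.zpowers z) = 1 :=
      (QuotientGroup.eq_one_iff z).2 (Subgroup.mem_zpowers z)
    have hmem : ψ z ∈ Subgroup.zpowers z := by
      rw [← QuotientGroup.eq_one_iff, hlift, hzN, map_one]
    have hfin : Finite (Subgroup.zpowers z) := by
      apply Nat.finite_of_card_ne_zero
      rw [Nat.card_zpowers, hord]
      exact pow_ne_zero _ hp.ne_zero
    have heq : Subgroup.zpowers (ψ z) = Subgroup.zpowers z := by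
      apply Subgroup.eq_of_le_of_card_ge
      · simpa using hmem
      · rw [Nat.card_zpowers, Nat.card_zpowers, hord, ho]
    constructor
    · rw [injective_iff_map_eq_one]
      intro g hg
      have h1 : g ∈ Subgroup.zpowers z := by
        rw [← QuotientGroup.eq_one_iff]
        apply φ.injective
        rw [← hlift, hg, map_one, QuotientGroup.mk_one]
      obtain ⟨n, rfl⟩ := Subgroup.mem_zpowers_iff.1 h1
      rw [map_zpow, ← orderOf_dvd_iff_zpow_eq_one, ho, ← hord] at hg
      exact orderOf_dvd_iff_zpow_eq_one.1 hg
    · intro y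
      obtain ⟨q, hq⟩ := φ.surjective (y : G ⧸ Subgroup.zpowers z)
      obtain ⟨g, rfl⟩ := QuotientGroup.mk_surjective q
      rw [← hlift, QuotientGroup.eq, ← heq] at hq
      obtain ⟨n, hn⟩ := Subgroup.mem_zpowers_iff.1 hq
      exact ⟨g * z ^ n, by rw [map_mul, map_zpow, hn, mul_inv_cancel_left]⟩
end

section
/- Let G be a group, let z be a central element of G of infinite order, and let N be the cyclic subgroup generated by z. Let φ be an automorphism of G/N and let ψ be an endomorphism of G that is a lift of φ. Then ψ is an automorphism of G if and only if ψ(z) = z or ψ(z) = z^{-1}. -/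
/-- Let `z` be a central element of `G` of infinite order and
`N = ⟨z⟩`.  Let `φ` be an automorphism of `G/N` and `ψ` an endomorphism of `G` lifting
`φ`.  Then `ψ` is an automorphism of `G` iff `ψ(z) = z` or `ψ(z) = z⁻¹`. -/
theorem lift_is_automorphism_iff_fixes_generator_up_to_inverse
    {G : Type*} [Group G]
    (z : G) (hz : z ∈ Subgroup.center G) (hord : ¬ IsOfFinOrder z)
    [(Subgroup.zpowers z).Normal]
    (φ : MulAut (G ⧸ Subgroup.zpowers z)) (ψ : G →* G)
    (hlift : ∀ g : G,
      ((ψ g : G) : G ⧸ Subgroup.zpowers z) = φ ((g : G ⧸ Subgroup.zpowers z))) :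
    Function.Bijective ψ ↔ (ψ z = z ∨ ψ z = z⁻¹) := by
  have hinj : Function.Injective (fun n : ℤ => z ^ n) :=
    injective_zpow_iff_not_isOfFinOrder.mpr hord
  have hmem : ∀ g : G, ψ g ∈ Subgroup.zpowers z ↔ g ∈ Subgroup.zpowers z := by
    intro g
    rw [← QuotientGroup.eq_one_iff, hlift g, ← QuotientGroup.eq_one_iff (N := Subgroup.zpowers z) g]
    exact map_eq_one_iff φ φ.injective
  constructor
  · rintro ⟨_, hs⟩
    obtain ⟨k, hk⟩ := Subgroup.mem_zpowers_iff.mp ((hmem z).mpr (Subgroup.mem_zpowers z))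
    obtain ⟨g, hg⟩ := hs z
    obtain ⟨m, rfl⟩ := Subgroup.mem_zpowers_iff.mp
      ((hmem g).mp (by rw [hg]; exact Subgroup.mem_zpowers z))
    rw [map_zpow, ← hk, ← zpow_mul] at hg
    have h1 : k * m = 1 := hinj (by simpa using hg)
    rcases Int.eq_one_or_neg_one_of_mul_eq_one h1 with h | h
    · left; rw [← hk, h, zpow_one]
    · right; rw [← hk, h, zpow_neg_one]
  · intro h
    have hN : ∀ m : ℤ, ∃ e : ℤ, ψ (z ^ e) = z ^ m := by
      intro m
      rcases h with h | h
      · exact ⟨m, by rw [map_zpow, h]⟩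
      · exact ⟨-m, by rw [map_zpow, h]; simp⟩
    constructor
    · rw [injective_iff_map_eq_one]
      intro g hg
      obtain ⟨m, rfl⟩ := Subgroup.mem_zpowers_iff.mp
        ((hmem g).mp (by rw [hg]; exact Subgroup.one_mem _))
      rw [map_zpow] at hg
      have h0 : z ^ m = 1 := by
        rcases h with h | h
        · rwa [h] at hg
        · rw [h] at hg; simpa using hg
      exact h0
    · intro y
      obtain ⟨q, hq⟩ := φ.surjective (y : G ⧸ Subgroup.zpowers z)
      obtain ⟨g, rfl⟩ := QuotientGroup.mk_surjective q
      have h2 : ((ψ g : G) : G ⧸ Subgroup.zpowers z) = y := (hlift g).trans hq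
      obtain ⟨m, hm⟩ := Subgroup.mem_zpowers_iff.mp (QuotientGroup.eq.mp h2)
      obtain ⟨e, he⟩ := hN m
      exact ⟨g * z ^ e, by rw [map_mul, he, hm]; group⟩
end

section
/- Let p be an odd prime, let n ≥ 4, and let G be the metacyclic group of order p^n presented by generators x, y and relations x^{p^{n-1}} = 1, y^p = 1, and y^{-1}xy = x^{1+p^{n-2}}. Let A := Aut(G) and Z := Z(A) its center. Then the canonical map Aut(A) → Aut(A/Z) is surjective: for every automorphism φ of A/Z there exists an automorphism ψ of A such that ψ(a)Z = φ(aZ) for all a ∈ A. -/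
/-- The relations `x^(p^(n-1))`, `y^p`, `y⁻¹xy·x^{-(1+p^(n-2))}` presenting the metacyclic
group of order `p^n`, with `x := FreeGroup.of 0` and `y := FreeGroup.of 1`. -/
def metacyclicRels (p n : ℕ) : Set (FreeGroup (Fin 2)) :=
  {FreeGroup.of 0 ^ p ^ (n - 1), FreeGroup.of 1 ^ p,
    (FreeGroup.of 1)⁻¹ * FreeGroup.of 0 * FreeGroup.of 1 *
      (FreeGroup.of 0 ^ (1 + p ^ (n - 2)))⁻¹}

namespace MC

structure Dat (p : ℕ) (R : Type) [CommRing R] where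
  rho : R →+* ZMod p
  iota : ZMod p →+ R
  h : ZMod p
  m : ℕ
  hh : h + h = 1
  smul : ∀ r c, iota (rho r * c) = r * iota c
  ri : ∀ c, rho (iota c) = 0
  surj : Function.Surjective rho
  inj : Function.Injective iota
  natR : ∀ r : R, ∃ k : ℕ, (k : R) = r
  ann : ∀ r : R, (p : R) * r = 0 → ∃ c, iota c = r
  qone : ((p ^ (m + 1) : ℕ) : R) = iota 1
  pord : ∀ r : R, rho r = 1 → r ^ (p ^ (m + 1)) = 1

variable {p : ℕ} {R : Type} [CommRing R]

/-- the group G -/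
@[ext] structure L (D : Dat p R) where
  a : R
  b : ZMod p

variable {D : Dat p R}

theorem Dat.ii (D : Dat p R) (c d : ZMod p) : D.iota c * D.iota d = 0 := by
  rw [← D.smul, D.ri, zero_mul, map_zero]

namespace L

instance : Mul (L D) := ⟨fun x y => ⟨x.a + y.a + D.iota (D.h * (D.rho x.a * y.b - x.b * D.rho y.a)), x.b + y.b⟩⟩
instance : One (L D) := ⟨⟨0, 0⟩⟩
instance : Inv (L D) := ⟨fun x => ⟨-x.a, -x.b⟩⟩

theorem mul_a (x y : L D) : (x * y).a = x.a + y.a + D.iota (D.h * (D.rho x.a * y.b - x.b * D.rho y.a)) := rfl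
theorem mul_b (x y : L D) : (x * y).b = x.b + y.b := rfl
theorem one_a : (1 : L D).a = 0 := rfl
theorem one_b : (1 : L D).b = 0 := rfl
theorem inv_a (x : L D) : (x⁻¹).a = -x.a := rfl
theorem inv_b (x : L D) : (x⁻¹).b = -x.b := rfl

instance : Group (L D) := Group.ofLeftAxioms
  (by
    intro x y z
    ext
    · simp only [mul_a, mul_b, map_add, D.ri]
      have h1 : D.h * (D.rho x.a * y.b - x.b * D.rho y.a) + D.h * ((D.rho x.a + D.rho y.a + 0) * z.b - (x.b + y.b) * D.rho z.a)
        = D.h * (D.rho y.a * z.b - y.b * D.rho z.a) + D.h * (D.rho x.a * (y.b + z.b) - x.b * (D.rho y.a + D.rho z.a + 0)) := by ring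
      have h2 := congrArg D.iota h1
      rw [map_add, map_add] at h2
      linear_combination h2
    · simp only [mul_b]; ring)
  (by
    intro x
    ext
    · simp [mul_a, one_a, one_b]
    · simp [mul_b, one_b])
  (by
    intro x
    ext
    · have : D.h * (-D.rho x.a * x.b - -x.b * D.rho x.a) = 0 := by ring
      simp only [mul_a, one_a, inv_a, inv_b, map_neg, this, map_zero]; ring
    · simp [mul_b, one_b, inv_b])

theorem pow_eq (x : L D) (k : ℕ) : x ^ k = ⟨k * x.a, k * x.b⟩ := by
  induction k with
  | zero => ext <;> simp [one_a, one_b]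
  | succ k ih =>
    rw [pow_succ, ih]
    ext
    · have : D.h * ((k : ZMod p) * D.rho x.a * x.b - k * x.b * D.rho x.a) = 0 := by ring
      simp only [mul_a, map_mul, map_natCast, this, map_zero]
      push_cast; ring
    · simp only [mul_b]; push_cast; ring

def X : L D := ⟨1, 0⟩
def Y : L D := ⟨0, 1⟩

theorem X_pow (k : ℕ) : (X : L D) ^ k = ⟨k, 0⟩ := by
  rw [pow_eq]; simp [X]
theorem Y_pow (k : ℕ) : (Y : L D) ^ k = ⟨0, k⟩ := by
  rw [pow_eq]; simp [Y]

theorem YX_pow (k l : ℕ) : (Y : L D) ^ k * X ^ l = ⟨l - D.iota (D.h * (k * l)), k⟩ := by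
  rw [X_pow, Y_pow]
  ext
  · simp [mul_a, sub_eq_add_neg]
  · simp [mul_b]

theorem exists_rep [NeZero p] (x : L D) : ∃ k l : ℕ, x = Y ^ k * X ^ l := by
  obtain ⟨l, hl⟩ := D.natR (x.a + D.iota (D.h * (x.b * D.rho x.a)))
  refine ⟨x.b.val, l, ?_⟩
  have : (l : ZMod p) = D.rho x.a := by
    rw [← map_natCast D.rho, hl, map_add, D.ri, add_zero]
  rw [YX_pow, ZMod.natCast_zmod_val, this, hl]
  ext <;> simp

theorem hom_ext [NeZero p] {f g : L D →* L D} (hX : f X = g X) (hY : f Y = g Y) : f = g := by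
  ext1 x
  obtain ⟨k, l, rfl⟩ := exists_rep x
  simp [hX, hY]

theorem rel : (Y : L D)⁻¹ * X * Y * (X ^ (1 + p ^ (D.m + 1)))⁻¹ = 1 := by
  have e : (D.rho ((1 + p ^ (D.m + 1) : ℕ) : R)) = 1 := by
    rw [Nat.cast_add, D.qone, map_add, D.ri]; simp
  have : (X : L D) * Y = Y * X ^ (1 + p ^ (D.m + 1)) := by
    rw [X_pow]
    ext
    · simp only [mul_a]
      rw [show (Y : L D).a = 0 from rfl, show (Y : L D).b = 1 from rfl,
        show (X : L D).a = 1 from rfl, show (X : L D).b = 0 from rfl, e, Nat.cast_add, D.qone]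
      have h1 := congrArg D.iota D.hh
      rw [map_add] at h1
      simp
      linear_combination h1
    · simp [mul_b, X, Y]
  rw [mul_assoc Y⁻¹, this]; group

end L

/-- unit 1 + iota c -/
def Dat.E (D : Dat p R) (c : ZMod p) : Rˣ where
  val := 1 + D.iota c
  inv := 1 - D.iota c
  val_inv := by linear_combination - D.ii c c
  inv_val := by linear_combination - D.ii c c

theorem Dat.E_add (D : Dat p R) (c d : ZMod p) : D.E (c + d) = D.E c * D.E d := by
  ext; simp only [Dat.E, Units.val_mul, map_add]; linear_combination - D.ii c d

theorem Dat.E_zero (D : Dat p R) : D.E 0 = 1 := by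
  ext; simp [Dat.E]

theorem Dat.E_pow (D : Dat p R) (c : ZMod p) (k : ℕ) : D.E c ^ k = D.E (k * c) := by
  induction k with
  | zero => simp [D.E_zero]
  | succ k ih => rw [pow_succ, ih, ← D.E_add]; congr 1; push_cast; ring

abbrev Dat.r (D : Dat p R) : Rˣ →* (ZMod p)ˣ := Units.map D.rho

theorem Dat.r_E (D : Dat p R) (c : ZMod p) : D.r (D.E c) = 1 := by
  ext; simp [Dat.E, D.ri]

/-- model of Aut G -/
@[ext] structure B (D : Dat p R) where
  u : Rˣ
  a : ZMod p
  k : ZMod p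

namespace B

instance : Mul (B D) := ⟨fun x y => ⟨x.u * y.u * D.E (D.h * (x.k * ((D.r x.u)⁻¹ : (ZMod p)ˣ) * y.a - x.a * D.r x.u * y.k)),
  x.a + ((D.r x.u)⁻¹ : (ZMod p)ˣ) * y.a, x.k + D.r x.u * y.k⟩⟩
instance : One (B D) := ⟨⟨1, 0, 0⟩⟩
instance : Inv (B D) := ⟨fun x => ⟨x.u⁻¹, - (D.r x.u * x.a), - ((D.r x.u)⁻¹ : (ZMod p)ˣ) * x.k⟩⟩

theorem mul_u (x y : B D) : (x * y).u = x.u * y.u * D.E (D.h * (x.k * ((D.r x.u)⁻¹ : (ZMod p)ˣ) * y.a - x.a * D.r x.u * y.k)) := rfl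
theorem mul_a (x y : B D) : (x * y).a = x.a + ((D.r x.u)⁻¹ : (ZMod p)ˣ) * y.a := rfl
theorem mul_k (x y : B D) : (x * y).k = x.k + D.r x.u * y.k := rfl
theorem one_u : (1 : B D).u = 1 := rfl
theorem one_a : (1 : B D).a = 0 := rfl
theorem one_k : (1 : B D).k = 0 := rfl
theorem inv_u (x : B D) : (x⁻¹).u = x.u⁻¹ := rfl
theorem inv_a (x : B D) : (x⁻¹).a = - (D.r x.u * x.a) := rfl
theorem inv_k (x : B D) : (x⁻¹).k = - ((D.r x.u)⁻¹ : (ZMod p)ˣ) * x.k := rfl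
theorem r_mul (x y : B D) : D.r (x * y).u = D.r x.u * D.r y.u := by
  rw [mul_u, map_mul, D.r_E, map_mul, mul_one]

instance : Group (B D) := Group.ofLeftAxioms
  (by
    intro x y z
    have hx : ((D.r x.u : (ZMod p)ˣ) : ZMod p) * ((D.r x.u)⁻¹ : (ZMod p)ˣ) = 1 := Units.mul_inv _
    ext1
    · rw [mul_u (x * y), mul_u x (y * z), r_mul, mul_u x y, mul_u y z]
      simp only [mul_a, mul_k, mul_inv]
      rw [show ∀ a b c d e : Rˣ, a * b * c * d * e = a * b * d * (c * e) by intros; simp only [mul_left_comm, mul_comm],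
        show ∀ a b c d e : Rˣ, a * (b * c * d) * e = a * b * c * (d * e) by intros; simp only [mul_assoc],
        ← D.E_add, ← D.E_add]
      congr 2
      push_cast
      generalize ((D.r x.u)⁻¹ : (ZMod p)ˣ).val = s at *
      generalize ((D.r y.u)⁻¹ : (ZMod p)ˣ).val = s' at *
      generalize (D.r x.u).val = t at *
      generalize (D.r y.u).val = t' at *
      linear_combination D.h * (y.k * s' * z.a - t' * y.a * z.k) * hx
    · rw [mul_a, r_mul]; simp only [mul_a, mul_inv]; push_cast; ring
    · rw [mul_k, r_mul]; simp only [mul_k]; push_cast; ring)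
  (by
    intro x
    ext1
    · simp [mul_u, one_a, one_k, one_u, D.E_zero]
    · simp [mul_a, one_a, one_u]
    · simp [mul_k, one_k, one_u])
  (by
    intro x
    ext1
    · rw [mul_u]
      simp only [inv_u, inv_a, inv_k, map_inv, inv_inv, one_u]
      rw [show D.h * (-((D.r x.u)⁻¹ : (ZMod p)ˣ).val * x.k * (D.r x.u).val * x.a - -((D.r x.u).val * x.a) * ((D.r x.u)⁻¹ : (ZMod p)ˣ).val * x.k) = 0 by ring, D.E_zero]
      simp
    · simp [mul_a, one_a, inv_a, inv_u]
    · simp [mul_k, one_k, inv_k, inv_u])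

/-- the action on G -/
def act (x : B D) : L D →* L D where
  toFun g := ⟨x.u * D.E (D.h * x.k * x.a) * g.a + D.iota (x.k * g.b), D.r x.u * x.a * D.rho g.a + g.b⟩
  map_one' := by ext <;> simp [L.one_a, L.one_b]
  map_mul' g g' := by
    have e : D.rho (D.E (D.h * x.k * x.a) : Rˣ) = 1 := congrArg Units.val (D.r_E (D.h * x.k * x.a))
    ext
    · simp only [L.mul_a, L.mul_b, map_add, map_mul, D.ri, e]
      have h1 := D.smul (x.u * D.E (D.h * x.k * x.a)) (D.h * (D.rho g.a * g'.b - g.b * D.rho g'.a))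
      rw [map_mul D.rho, e] at h1
      rw [mul_add, ← h1]
      have h2 : D.rho x.u * 1 * (D.h * (D.rho g.a * g'.b - g.b * D.rho g'.a)) + x.k * (g.b + g'.b)
        = (x.k * g.b + x.k * g'.b) + D.h * ((D.rho x.u * 1 * D.rho g.a + 0) * ((D.r x.u).val * x.a * D.rho g'.a + g'.b) -
          ((D.r x.u).val * x.a * D.rho g.a + g.b) * (D.rho x.u * 1 * D.rho g'.a + 0)) := by ring
      have h3 := congrArg D.iota h2
      rw [map_add, map_add, map_add D.iota (x.k * g.b)] at h3
      linear_combination h3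
    · simp only [L.mul_a, L.mul_b, map_add, D.ri]; ring

theorem act_a (x : B D) (g : L D) : (act x g).a = x.u * D.E (D.h * x.k * x.a) * g.a + D.iota (x.k * g.b) := rfl
theorem act_b (x : B D) (g : L D) : (act x g).b = D.r x.u * x.a * D.rho g.a + g.b := rfl

theorem act_one : act (1 : B D) = MonoidHom.id _ := by
  ext g
  · simp [act_a, one_u, one_a, one_k, D.E_zero]
  · simp [act_b, one_u, one_a]

theorem act_mul (x y : B D) : act (x * y) = (act x).comp (act y) := by
  have hx : (D.r x.u).val * ((D.r x.u)⁻¹ : (ZMod p)ˣ).val = 1 := Units.mul_inv _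
  have key : (x * y).u * D.E (D.h * (x * y).k * (x * y).a) =
      (x.u * D.E (D.h * x.k * x.a)) * (y.u * D.E (D.h * y.k * y.a)) *
        D.E (x.k * ((D.r x.u)⁻¹ : (ZMod p)ˣ) * y.a) := by
    rw [mul_u, mul_k, mul_a, mul_assoc (x.u * y.u), ← D.E_add,
      show ∀ a b c d e : Rˣ, (a * b) * (c * d) * e = a * c * (b * d * e) by
        intros; simp only [mul_assoc, mul_left_comm], ← D.E_add, ← D.E_add]
    congr 2
    generalize ((D.r x.u)⁻¹ : (ZMod p)ˣ).val = s at *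
    generalize (D.r x.u).val = t at *
    linear_combination (D.h * y.k * y.a) * hx + x.k * s * y.a * D.hh
  have e : ∀ c, D.rho (D.E c : Rˣ) = 1 := fun c => congrArg Units.val (D.r_E c)
  ext g
  · rw [act_a, MonoidHom.comp_apply, act_a, act_a, act_b, ← Units.val_mul, key]
    have h1 := D.smul (x.u * D.E (D.h * x.k * x.a)) (y.k * g.b)
    have h2 := D.smul ((x.u * D.E (D.h * x.k * x.a)) * (y.u * D.E (D.h * y.k * y.a)) * g.a)
      (x.k * ((D.r x.u)⁻¹ : (ZMod p)ˣ) * y.a)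
    simp only [map_mul D.rho, e] at h1 h2
    rw [mul_k]
    have h3 : (D.rho x.u * 1 * (D.rho y.u * 1) * D.rho g.a * (x.k * ((D.r x.u)⁻¹ : (ZMod p)ˣ) * y.a))
      + (x.k + (D.r x.u).val * y.k) * g.b =
      D.rho x.u * 1 * (y.k * g.b) + x.k * ((D.r y.u).val * y.a * D.rho g.a + g.b) := by
      rw [show D.rho x.u = (D.r x.u).val from rfl, show D.rho y.u = (D.r y.u).val from rfl]
      linear_combination ((D.r y.u).val * D.rho g.a * x.k * y.a) * hx
    have h4 := congrArg D.iota h3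
    rw [map_add, map_add] at h4
    rw [h1, h2] at h4
    simp only [Units.val_mul]
    rw [show ((D.E (x.k * ((D.r x.u)⁻¹ : (ZMod p)ˣ) * y.a) : Rˣ) : R) = 1 + D.iota (x.k * ((D.r x.u)⁻¹ : (ZMod p)ˣ) * y.a) from rfl]
    linear_combination h4
  · rw [act_b, MonoidHom.comp_apply, act_b, act_b, act_a, mul_a, r_mul]
    simp only [map_add D.rho, map_mul D.rho, D.ri, e]
    rw [show D.rho y.u = (D.r y.u).val from rfl]
    push_cast
    linear_combination ((D.r y.u).val * D.rho g.a * y.a) * hx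

def toAut : B D →* MulAut (L D) where
  toFun x := MonoidHom.toMulEquiv (act x) (act x⁻¹)
    (by rw [← act_mul, inv_mul_cancel, act_one]) (by rw [← act_mul, mul_inv_cancel, act_one])
  map_one' := by ext1 g; exact DFunLike.congr_fun act_one g
  map_mul' x y := by ext1 g; exact DFunLike.congr_fun (act_mul x y) g

theorem toAut_apply (x : B D) (g : L D) : toAut x g = act x g := rfl

theorem toAut_inj : Function.Injective (toAut : B D → MulAut (L D)) := by
  rw [injective_iff_map_eq_one]
  intro x hx
  have h1 : act x L.X = L.X := by rw [← toAut_apply, hx]; rfl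
  have h2 : act x L.Y = L.Y := by rw [← toAut_apply, hx]; rfl
  have hk : x.k = 0 := by
    have := congrArg L.a h2
    simp only [act_a, L.Y, mul_zero, zero_add, mul_one] at this
    exact D.inj (this.trans (map_zero _).symm)
  have ha : x.a = 0 := by
    have := congrArg L.b h1
    rw [act_b] at this
    simp only [L.X, map_one, mul_one, add_zero] at this
    exact (Units.mul_right_eq_zero _).1 this
  have hu : x.u = 1 := by
    have := congrArg L.a h1
    rw [act_a, hk, ha] at this
    ext
    simpa [L.X, D.E_zero] using this
  ext1 <;> assumption

theorem toAut_surj [Fact p.Prime] : Function.Surjective (toAut : B D → MulAut (L D)) := by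
  intro f
  have hrp : ∀ c : R, D.rho c = 0 → (D.iota 1 : R) * c = 0 := by
    intro c hc; rw [mul_comm, ← D.smul, hc, zero_mul, map_zero]
  obtain ⟨k, hk⟩ : ∃ k, D.iota k = (f L.Y).a := by
    apply D.ann
    have h1 : f (L.Y ^ p) = 1 := by
      rw [L.Y_pow, CharP.cast_eq_zero]; exact map_one f
    rw [map_pow, L.pow_eq] at h1
    exact congrArg L.a h1
  have hi : D.rho (f L.X).a ≠ 0 := by
    intro h0
    have h1 : f (L.X ^ (p ^ (D.m + 1))) = 1 := by
      rw [map_pow, L.pow_eq]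
      ext
      · simp only [L.one_a]; rw [D.qone]; exact hrp _ h0
      · simp [L.one_b]
    rw [← map_one f] at h1
    have h2 := congrArg L.a (f.injective h1)
    rw [L.X_pow] at h2
    simp only [L.one_a] at h2
    rw [D.qone, ← map_zero D.iota] at h2
    exact one_ne_zero (D.inj h2)
  obtain ⟨i, hiu⟩ : ∃ i : Rˣ, (i : R) = (f L.X).a := by
    obtain ⟨r, hr⟩ := D.surj (D.rho (f L.X).a)⁻¹
    have : IsUnit ((f L.X).a * r) := by
      apply IsUnit.of_pow_eq_one (n := p ^ (D.m + 1))
      · apply D.pord; rw [map_mul, hr, mul_inv_cancel₀ hi]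
      · exact pow_ne_zero _ (Fact.out : p.Prime).ne_zero
    exact isUnit_of_mul_isUnit_left this
  have hb : (f L.Y).b = 1 := by
    have h1 := congrArg f (L.rel (D := D))
    rw [map_one, map_mul, map_mul, map_mul, map_inv, map_inv, map_pow, mul_inv_eq_one, mul_assoc, inv_mul_eq_iff_eq_mul, L.pow_eq] at h1
    have h2 := congrArg L.a h1
    simp only [L.mul_a, map_mul D.rho, ← hk, D.ri] at h2
    rw [Nat.cast_add, D.qone] at h2
    simp only [map_add D.rho, D.ri] at h2
    have h3 : D.iota (D.rho (f L.X).a * (f L.Y).b) = D.iota (D.rho (f L.X).a * 1) := by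
      have h5 : D.rho (f L.X).a * (f L.Y).b + D.h * (0 * ((1 + p ^ (D.m + 1) : ℕ) * (f L.X).b) - (f L.Y).b * ((D.rho (Nat.cast 1) + 0) * D.rho (f L.X).a)) =
         D.h * (D.rho (f L.X).a * (f L.Y).b - (f L.X).b * 0) := by
        rw [Nat.cast_one, map_one]
        linear_combination - (D.rho (f L.X).a * (f L.Y).b) * D.hh
      have h6 := congrArg D.iota h5
      rw [map_add] at h6
      rw [D.smul _ 1]
      push_cast at h2 h6
      linear_combination h6 + h2
    exact mul_left_cancel₀ hi (D.inj h3)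
  have hri : D.rho (f L.X).a = (D.r i).val := by rw [← hiu]; rfl
  let a := ((D.r i)⁻¹ : (ZMod p)ˣ).val * (f L.X).b
  refine ⟨⟨i * (D.E (D.h * k * a))⁻¹, a, k⟩, ?_⟩
  have e : ∀ c, D.r (D.E c : Rˣ)⁻¹ = 1 := fun c => by rw [map_inv, D.r_E, inv_one]
  apply MulEquiv.toMonoidHom_injective
  apply L.hom_ext
  · ext
    · change (act _ _).a = (f L.X).a
      rw [act_a, ← hiu]; simp [L.X]
    · change (act _ _).b = (f L.X).b
      rw [act_b, map_mul D.r, e, mul_one]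
      simp only [a]
      rw [Units.mul_inv_cancel_left, show (L.X : L D).a = 1 from rfl, show (L.X : L D).b = 0 from rfl]
      simp
  · ext
    · change (act _ _).a = (f L.Y).a
      rw [act_a, ← hk]; simp [L.Y]
    · change (act _ _).b = (f L.Y).b
      rw [act_b, hb]; simp [L.Y]

noncomputable def equivAut [Fact p.Prime] : B D ≃* MulAut (L D) :=
  MulEquiv.ofBijective toAut ⟨toAut_inj, toAut_surj⟩

instance [Finite R] [NeZero p] : Finite (B D) :=
  Finite.of_injective (fun x : B D => (x.u, x.a, x.k)) (by
    rintro ⟨⟩ ⟨⟩ h; simpa using h)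

end B

/-- model of the central quotient -/
@[ext] structure C (p : ℕ) where
  t : (ZMod p)ˣ
  a : ZMod p
  k : ZMod p

namespace C
instance : Mul (C p) := ⟨fun x y => ⟨x.t * y.t, x.a + (x.t⁻¹ : (ZMod p)ˣ) * y.a, x.k + x.t * y.k⟩⟩
instance : One (C p) := ⟨⟨1, 0, 0⟩⟩
instance : Inv (C p) := ⟨fun x => ⟨x.t⁻¹, - (x.t * x.a), - (x.t⁻¹ : (ZMod p)ˣ) * x.k⟩⟩

theorem mul_t (x y : C p) : (x * y).t = x.t * y.t := rfl
theorem mul_a (x y : C p) : (x * y).a = x.a + (x.t⁻¹ : (ZMod p)ˣ) * y.a := rfl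
theorem mul_k (x y : C p) : (x * y).k = x.k + x.t * y.k := rfl
theorem one_t : (1 : C p).t = 1 := rfl
theorem one_a : (1 : C p).a = 0 := rfl
theorem one_k : (1 : C p).k = 0 := rfl
theorem inv_t (x : C p) : (x⁻¹).t = x.t⁻¹ := rfl
theorem inv_a (x : C p) : (x⁻¹).a = - (x.t * x.a) := rfl
theorem inv_k (x : C p) : (x⁻¹).k = - (x.t⁻¹ : (ZMod p)ˣ) * x.k := rfl

instance : Group (C p) := Group.ofLeftAxioms
  (by
    intro x y z
    ext1
    · simp only [mul_t, mul_assoc]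
    · simp only [mul_t, mul_a, mul_inv]; push_cast; ring
    · simp only [mul_t, mul_k]; push_cast; ring)
  (by
    intro x
    ext1
    · simp [mul_t, one_t]
    · simp [mul_a, one_a, one_t]
    · simp [mul_k, one_k, one_t])
  (by
    intro x
    ext1
    · simp [mul_t, one_t, inv_t]
    · simp [mul_a, one_a, inv_a, inv_t]
    · simp [mul_k, one_k, inv_k, inv_t])

def T : (ZMod p)ˣ →* C p where
  toFun t := ⟨t, 0, 0⟩
  map_one' := rfl
  map_mul' x y := by ext1 <;> simp [mul_t, mul_a, mul_k]

def v (a k : ZMod p) : C p := ⟨1, a, k⟩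

theorem v_mul (a k a' k' : ZMod p) : v a k * v a' k' = v (a + a') (k + k') := by
  ext1 <;> simp [v, mul_t, mul_a, mul_k]

theorem v_zero : v (0 : ZMod p) 0 = 1 := rfl

theorem v_pow (a k : ZMod p) (m : ℕ) : v a k ^ m = v ((m : ZMod p) * a) ((m : ZMod p) * k) := by
  induction m with
  | zero => simp [v_zero]
  | succ m ih => rw [pow_succ, ih, v_mul]; congr 1 <;> push_cast <;> ring

theorem v_mul_T (a k : ZMod p) (t : (ZMod p)ˣ) : v a k * T t = ⟨t, a, k⟩ := by
  ext1 <;> simp [v, T, mul_t, mul_a, mul_k]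

theorem T_mul_v (a k : ZMod p) (t : (ZMod p)ˣ) :
    T t * v a k = ⟨t, (t⁻¹ : (ZMod p)ˣ) * a, t * k⟩ := by
  ext1 <;> simp [v, T, mul_t, mul_a, mul_k]

def toT : C p →* (ZMod p)ˣ where
  toFun x := x.t
  map_one' := rfl
  map_mul' _ _ := rfl

variable [Fact p.Prime]

theorem pow_p_iff (x : C p) : x ^ p = 1 ↔ x.t = 1 := by
  constructor
  · intro h
    have h1 := congrArg toT h
    rw [map_pow, map_one] at h1
    have h2 := congrArg Units.val h1
    rw [Units.val_pow_eq_pow_val, ZMod.pow_card] at h2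
    exact Units.ext h2
  · intro h
    have : x = v x.a x.k := by ext1 <;> simp [v, h]
    rw [this, v_pow]; simp [v_zero]

theorem map_v (φ : MulAut (C p)) (a k : ZMod p) : ∃ a' k', φ (v a k) = v a' k' := by
  refine ⟨(φ (v a k)).a, (φ (v a k)).k, ?_⟩
  have : (φ (v a k)).t = 1 := by
    rw [← pow_p_iff, ← map_pow, (pow_p_iff _).2 rfl, map_one]
  ext1
  · exact this
  · rfl
  · rfl

theorem t_ne (φ : MulAut (C p)) (t : (ZMod p)ˣ) (ht : t ≠ 1) : (φ (T t)).t ≠ 1 := by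
  intro h
  rw [← pow_p_iff, ← map_pow] at h
  have := φ.injective (h.trans (map_one φ).symm)
  exact ht ((pow_p_iff _).1 this)

end C

def pi : B D →* C p where
  toFun x := ⟨D.r x.u, x.a, x.k⟩
  map_one' := by ext1 <;> simp [C.one_t, C.one_a, C.one_k, B.one_u, B.one_a, B.one_k]
  map_mul' x y := by
    ext1
    · exact B.r_mul x y
    · rfl
    · rfl

theorem r_surj [Fact p.Prime] (D : Dat p R) : Function.Surjective D.r := by
  intro t
  obtain ⟨x, hx⟩ := D.surj t
  have : IsUnit x := by
    obtain ⟨r, hr⟩ := D.surj (t⁻¹ : (ZMod p)ˣ)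
    have : IsUnit (x * r) := by
      apply IsUnit.of_pow_eq_one (n := p ^ (D.m + 1))
      · apply D.pord; rw [map_mul, hr, hx, Units.mul_inv]
      · exact pow_ne_zero _ (Fact.out : p.Prime).ne_zero
    exact isUnit_of_mul_isUnit_left this
  obtain ⟨u, rfl⟩ := this
  exact ⟨u, Units.ext hx⟩

theorem pi_surj [Fact p.Prime] : Function.Surjective (pi : B D → C p) := by
  intro x
  obtain ⟨u, hu⟩ := r_surj D x.t
  refine ⟨⟨u, x.a, x.k⟩, ?_⟩
  ext1
  · exact hu
  · rfl
  · rfl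

theorem ker_pi : (pi : B D →* C p).ker = Subgroup.center (B D) := by
  have z : ∀ a : ZMod p, a = -a → a = 0 := by
    intro a ha
    linear_combination D.h * ha - a * D.hh
  ext x
  rw [MonoidHom.mem_ker, Subgroup.mem_center_iff]
  constructor
  · intro h y
    have h1 : D.r x.u = 1 := congrArg C.t h
    have h2 : x.a = 0 := congrArg C.a h
    have h3 : x.k = 0 := congrArg C.k h
    ext1
    · rw [B.mul_u, B.mul_u, h1, h2, h3]; simp [D.E_zero, mul_comm]
    · rw [B.mul_a, B.mul_a, h1, h2]; simp
    · rw [B.mul_k, B.mul_k, h1, h3]; simp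
  · intro h
    have h1 := h ⟨-1, 0, 0⟩
    have hr : D.r (-1) = -1 := by ext; simp
    have ha : x.a = 0 := by
      have := congrArg B.a h1
      rw [B.mul_a, B.mul_a] at this
      simp only [hr] at this
      apply z
      simpa using this.symm
    have hk : x.k = 0 := by
      have := congrArg B.k h1
      rw [B.mul_k, B.mul_k] at this
      simp only [hr] at this
      apply z
      simpa using this.symm
    have ht : D.r x.u = 1 := by
      have := congrArg B.k (h ⟨1, 0, 1⟩)
      rw [B.mul_k, B.mul_k] at this
      simp only [hk, map_one] at this
      ext
      simpa using this.symm
    ext1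
    · exact ht
    · exact ha
    · exact hk

theorem lift_one [Fact p.Prime] [Finite R] (φ : MulAut (C p)) (r : ℕ)
    (hr : ∀ t, φ (C.T t) = C.T (t ^ r)) :
    ∃ ψ : MulAut (B D), ∀ b, pi (ψ b) = φ (pi b) := by
  have hpp : p.Prime := Fact.out
  obtain ⟨α, β, h1⟩ := C.map_v φ 1 0
  obtain ⟨γ, δ, h2⟩ := C.map_v φ 0 1
  have hv : ∀ a k, φ (C.v a k) = C.v (a * α + k * γ) (a * β + k * δ) := by
    intro a k
    have : C.v a k = C.v 1 0 ^ a.val * C.v 0 1 ^ k.val := by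
      rw [C.v_pow, C.v_pow, C.v_mul]; simp
    rw [this, map_mul, map_pow, map_pow, h1, h2, C.v_pow, C.v_pow, C.v_mul]; simp
  have hall : ∀ t a k, φ ⟨t, a, k⟩ = ⟨t ^ r, a * α + k * γ, a * β + k * δ⟩ := by
    intro t a k
    rw [← C.v_mul_T, map_mul, hv, hr, C.v_mul_T]
  have hc : ∀ (t : (ZMod p)ˣ) a k, φ (C.T t * C.v a k) = C.T (t ^ r) * φ (C.v a k) := by
    intro t a k; rw [map_mul, hr]
  have hα : ∀ t : (ZMod p)ˣ, (t⁻¹ : (ZMod p)ˣ).val * α = ((t ^ r)⁻¹ : (ZMod p)ˣ).val * α := by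
    intro t
    have := congrArg C.a (hc t 1 0)
    rw [C.T_mul_v, hall, h1, C.T_mul_v] at this
    simp only [mul_one, mul_zero, one_mul, zero_mul, add_zero, zero_add] at this
    exact this
  have hβ : ∀ t : (ZMod p)ˣ, (t⁻¹ : (ZMod p)ˣ).val * β = (t ^ r : (ZMod p)ˣ).val * β := by
    intro t
    have := congrArg C.k (hc t 1 0)
    rw [C.T_mul_v, hall, h1, C.T_mul_v] at this
    simp only [mul_one, mul_zero, one_mul, zero_mul, add_zero, zero_add] at this
    exact this
  have hγ : ∀ t : (ZMod p)ˣ, t.val * γ = ((t ^ r)⁻¹ : (ZMod p)ˣ).val * γ := by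
    intro t
    have := congrArg C.a (hc t 0 1)
    rw [C.T_mul_v, hall, h2, C.T_mul_v] at this
    simp only [mul_one, mul_zero, one_mul, zero_mul, add_zero, zero_add] at this
    exact this
  have hδ : ∀ t : (ZMod p)ˣ, t.val * δ = (t ^ r : (ZMod p)ˣ).val * δ := by
    intro t
    have := congrArg C.k (hc t 0 1)
    rw [C.T_mul_v, hall, h2, C.T_mul_v] at this
    simp only [mul_one, mul_zero, one_mul, zero_mul, add_zero, zero_add] at this
    exact this
  have hinj : ∀ a k, a * α + k * γ = 0 → a * β + k * δ = 0 → a = 0 ∧ k = 0 := by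
    intro a k e1 e2
    have : φ (C.v a k) = φ 1 := by rw [hv, e1, e2, map_one]; rfl
    have := φ.injective this
    exact ⟨congrArg C.a this, congrArg C.k this⟩
  have hd : α * δ - β * γ ≠ 0 := by
    intro hd
    have i1 := hinj δ (-β) (by linear_combination hd) (by ring)
    have i2 := hinj γ (-α) (by ring) (by linear_combination -hd)
    have i3 := hinj 1 0 (by linear_combination -i2.2) (by linear_combination -i1.2)
    exact one_ne_zero i3.1
  have hcop : (p - 1).Coprime p := by
    have := Nat.coprime_self_sub_left (m := 1) (n := p) hpp.one_lt.le
    exact this.2 (Nat.coprime_one_left p)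
  obtain ⟨M, hM1, hM2⟩ := Nat.chineseRemainder hcop r (α * δ - β * γ).val
  have hM : (M : ZMod p) = α * δ - β * γ := by
    have := (ZMod.natCast_eq_natCast_iff _ _ _).2 hM2
    rw [this, ZMod.natCast_zmod_val]
  have hMr : ∀ t : (ZMod p)ˣ, t ^ M = t ^ r := by
    intro t
    apply pow_eq_pow_iff_modEq.2
    apply hM1.of_dvd
    exact orderOf_dvd_of_pow_eq_one (ZMod.units_pow_card_sub_one_eq_one p t)
  let f : B D →* B D :=
    { toFun := fun x => ⟨x.u ^ M, x.a * α + x.k * γ, x.a * β + x.k * δ⟩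
      map_one' := by ext1 <;> simp [B.one_u, B.one_a, B.one_k]
      map_mul' := by
        intro x y
        have a1 := hα (D.r x.u)
        have a2 := hβ (D.r x.u)
        have a3 := hγ (D.r x.u)
        have a4 := hδ (D.r x.u)
        ext1
        · rw [B.mul_u, B.mul_u, mul_pow, mul_pow, D.E_pow, hM]
          simp only [map_pow D.r, hMr]
          congr 2
          generalize ((D.r x.u ^ r)⁻¹ : (ZMod p)ˣ).val = S at *
          generalize (D.r x.u ^ r).val = S' at *
          generalize ((D.r x.u)⁻¹ : (ZMod p)ˣ).val = s at *
          generalize (D.r x.u).val = s' at *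
          linear_combination D.h * ((x.a * β + x.k * δ) * (y.a * a1 + y.k * a3) -
            (x.a * α + x.k * γ) * (y.a * a2 + y.k * a4))
        · simp only [B.mul_a, B.mul_k, map_pow D.r, hMr]
          linear_combination y.a * a1 + y.k * a3
        · simp only [B.mul_a, B.mul_k, map_pow D.r, hMr]
          linear_combination y.a * a2 + y.k * a4 }
  have hf : Function.Injective f := by
    rw [injective_iff_map_eq_one]
    intro x hx
    have e1 : x.u ^ M = 1 := congrArg B.u hx
    obtain ⟨e2, e3⟩ := hinj x.a x.k (congrArg B.a hx) (congrArg B.k hx)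
    have e4 : D.r x.u = 1 := by
      have : φ (C.T (D.r x.u)) = φ 1 := by
        rw [hr, ← hMr, ← map_pow, e1, map_one, map_one, map_one]
      exact congrArg C.t (φ.injective this)
    have e5 : x.u ^ (p ^ (D.m + 1)) = 1 := by
      ext; push_cast; exact D.pord _ (congrArg Units.val e4)
    have e6 : Nat.Coprime M (p ^ (D.m + 1)) := by
      apply Nat.Coprime.pow_right
      rw [Nat.coprime_comm, hpp.coprime_iff_not_dvd, ← ZMod.natCast_eq_zero_iff, hM]
      exact hd
    have e7 : x.u = 1 := by
      rw [← orderOf_eq_one_iff, ← Nat.dvd_one, ← e6.gcd_eq_one]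
      exact Nat.dvd_gcd (orderOf_dvd_of_pow_eq_one e1) (orderOf_dvd_of_pow_eq_one e5)
    ext1 <;> assumption
  refine ⟨MulEquiv.ofBijective f (Finite.injective_iff_bijective.1 hf), ?_⟩
  intro b
  have : φ (pi b) = φ ⟨D.r b.u, b.a, b.k⟩ := rfl
  rw [this, hall, ← hMr, ← map_pow]
  rfl

theorem lift_all [Fact p.Prime] [Finite R] (φ : MulAut (C p)) :
    ∃ ψ : MulAut (B D), ∀ b, pi (ψ b) = φ (pi b) := by
  obtain ⟨τ, hτ⟩ := IsCyclic.exists_generator (α := (ZMod p)ˣ)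
  have hτ1 : τ ≠ 1 := by
    rintro rfl
    have := hτ (-1)
    simp only [Subgroup.zpowers_one_eq_bot, Subgroup.mem_bot] at this
    have h1 : (-1 : ZMod p) = 1 := congrArg Units.val this
    have : (1 : ZMod p) = 0 := by linear_combination - D.hh - D.h * h1
    exact one_ne_zero this
  have hs := C.t_ne φ τ hτ1
  set s := (φ (C.T τ)).t with hsdef
  have n1 : (1 - (s⁻¹ : (ZMod p)ˣ).val) ≠ 0 := by
    rw [sub_ne_zero]; intro h
    apply hs; rw [← inv_eq_one]; exact Units.ext h.symm
  have n2 : (1 - s.val) ≠ 0 := by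
    rw [sub_ne_zero]; intro h
    exact hs (Units.ext h.symm)
  let c : C p := C.v ((φ (C.T τ)).a / (1 - (s⁻¹ : (ZMod p)ˣ).val)) ((φ (C.T τ)).k / (1 - s.val))
  have hc : c * C.T s = φ (C.T τ) * c := by
    have e : φ (C.T τ) = ⟨s, (φ (C.T τ)).a, (φ (C.T τ)).k⟩ := rfl
    rw [e, C.v_mul_T]
    ext1
    · simp only [C.mul_t, c, C.v, mul_one]
    · simp only [C.mul_a, c, C.v]; field_simp; ring
    · simp only [C.mul_k, c, C.v]; field_simp; ring
  obtain ⟨r, hr⟩ : ∃ r : ℕ, τ ^ r = s := (mem_powers_iff_mem_zpowers.2 (hτ s))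
  obtain ⟨b0, hb0⟩ := pi_surj (D := D) c
  obtain ⟨ψ, hψ⟩ := lift_one (D := D) ((MulAut.conj c)⁻¹ * φ) r (by
    intro t
    obtain ⟨l, rfl⟩ : ∃ l : ℕ, τ ^ l = t := (mem_powers_iff_mem_zpowers.2 (hτ t))
    have : ((MulAut.conj c)⁻¹ * φ) (C.T τ) = C.T s := by
      rw [MulAut.mul_apply, MulAut.conj_inv_apply, mul_assoc, ← hc]; group
    rw [map_pow, map_pow, this, ← map_pow, ← hr, ← pow_mul, ← pow_mul, mul_comm])
  refine ⟨MulAut.conj b0 * ψ, fun b => ?_⟩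
  rw [MulAut.mul_apply, MulAut.conj_apply, map_mul, map_mul, map_inv, hψ, hb0,
    MulAut.mul_apply, MulAut.conj_inv_apply]
  group

theorem quot_lift {A C : Type*} [Group A] [Group C] (N : Subgroup A) [N.Normal] (f : A →* C)
    (hN : N = f.ker) (hf : Function.Surjective f)
    (H : ∀ φ : MulAut C, ∃ ψ : MulAut A, ∀ a, f (ψ a) = φ (f a)) (φ : MulAut (A ⧸ N)) :
    ∃ ψ : MulAut A, ∀ a : A, ((ψ a : A) : A ⧸ N) = φ (a : A ⧸ N) := by
  subst hN
  let e := QuotientGroup.quotientKerEquivOfSurjective f hf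
  obtain ⟨ψ, hψ⟩ := H (MulAut.congr e φ)
  refine ⟨ψ, fun a => e.injective ?_⟩
  have h1 : ∀ a : A, e (a : A ⧸ f.ker) = f a := fun a => rfl
  rw [h1, hψ, ← h1 a]
  simp [MulAut.congr]

theorem main_abs [Fact p.Prime] [Finite R] {P : Type*} [Group P] (e : P ≃* L D)
    (φ : MulAut (MulAut P ⧸ Subgroup.center (MulAut P))) :
    ∃ ψ : MulAut (MulAut P), ∀ a : MulAut P, ((ψ a : MulAut P) : MulAut P ⧸ Subgroup.center (MulAut P)) =
      φ (a : MulAut P ⧸ Subgroup.center (MulAut P)) := by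
  let e2 : MulAut P ≃* B D := (MulAut.congr e).trans B.equivAut.symm
  refine quot_lift _ ((pi : B D →* C p).comp e2.toMonoidHom) ?_ ?_ ?_ φ
  · ext x
    have h1 : x ∈ ((pi : B D →* C p).comp e2.toMonoidHom).ker ↔ e2 x ∈ (pi : B D →* C p).ker := Iff.rfl
    rw [h1, ker_pi, Subgroup.mem_center_iff, Subgroup.mem_center_iff]
    constructor
    · intro h g
      obtain ⟨g, rfl⟩ := e2.surjective g
      rw [← map_mul, ← map_mul, h]
    · intro h g
      apply e2.injective
      rw [map_mul, map_mul, h]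
  · exact pi_surj.comp e2.surjective
  · intro φ
    obtain ⟨ψ, hψ⟩ := lift_all (D := D) φ
    refine ⟨MulAut.congr e2.symm ψ, fun a => ?_⟩
    change pi (e2 (e2.symm (ψ (e2 a)))) = φ (pi (e2 a))
    rw [e2.apply_symm_apply, hψ]

/-- concrete data -/
noncomputable def dat (p m : ℕ) [Fact p.Prime] (hodd : Odd p) : Dat p (ZMod (p ^ (m + 2))) :=
  have hpp : p.Prime := Fact.out
  have hdvd : p ∣ p ^ (m + 2) := dvd_pow_self _ (by omega)
  have hz : ((p : ZMod (p ^ (m + 2))) ^ (m + 2)) = 0 := by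
    have := ZMod.natCast_self (p ^ (m + 2)); push_cast at this; exact this
  have hl : ∀ k : ℤ, ZMod.lift p (A := ZMod (p ^ (m + 2))) ⟨(AddMonoidHom.mulLeft ((p : ZMod (p ^ (m + 2))) ^ (m + 1))).comp (Int.castAddHom _),
      by simp [← pow_succ, hz]⟩ (k : ZMod p) = (p : ZMod (p ^ (m + 2))) ^ (m + 1) * k := by
    intro k; rw [ZMod.lift_coe]; rfl
  have hN : ∀ r : ZMod (p ^ (m + 2)), ∃ k : ℕ, (k : ZMod (p ^ (m + 2))) = r := by
    have : NeZero (p ^ (m + 2)) := ⟨pow_ne_zero _ hpp.ne_zero⟩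
    exact fun r => ⟨r.val, ZMod.natCast_zmod_val r⟩
  { rho := ZMod.castHom hdvd (ZMod p)
    iota := ZMod.lift p ⟨(AddMonoidHom.mulLeft ((p : ZMod (p ^ (m + 2))) ^ (m + 1))).comp (Int.castAddHom _),
      by simp [← pow_succ, hz]⟩
    h := 2⁻¹
    m := m
    hh := by
      have : (2 : ZMod p) ≠ 0 := by
        have : ((2 : ℕ) : ZMod p) ≠ 0 := by
          rw [Ne, ZMod.natCast_eq_zero_iff]
          intro h
          have := (Nat.prime_dvd_prime_iff_eq hpp Nat.prime_two).1 h
          subst this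
          exact absurd hodd (by decide)
        exact_mod_cast this
      field_simp; norm_num
    smul := by
      intro r c
      obtain ⟨k, rfl⟩ := hN r
      obtain ⟨l, rfl⟩ := ZMod.intCast_surjective c
      have e : ZMod.castHom hdvd (ZMod p) (k : ZMod (p ^ (m + 2))) * (l : ZMod p) = (((k : ℤ) * l : ℤ) : ZMod p) := by
        rw [map_natCast]; push_cast; rfl
      refine (congrArg _ e).trans ?_
      rw [hl, hl]; push_cast; ring
    ri := by
      intro c
      obtain ⟨l, rfl⟩ := ZMod.intCast_surjective c
      rw [hl, map_mul, map_pow, map_natCast]; simp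
    surj := by
      intro c
      obtain ⟨l, rfl⟩ := ZMod.intCast_surjective c
      exact ⟨l, map_intCast _ _⟩
    inj := by
      rw [injective_iff_map_eq_zero]
      intro c hc
      obtain ⟨l, rfl⟩ := ZMod.intCast_surjective c
      rw [hl] at hc
      have h1 : (((p : ℤ) ^ (m + 1) * l : ℤ) : ZMod (p ^ (m + 2))) = 0 := by push_cast; exact hc
      rw [ZMod.intCast_zmod_eq_zero_iff_dvd] at h1 ⊢
      push_cast at h1
      rw [pow_succ _ (m + 1)] at h1
      exact Int.dvd_of_mul_dvd_mul_left (pow_ne_zero _ (by exact_mod_cast hpp.ne_zero)) h1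
    natR := hN
    ann := by
      intro r hr
      obtain ⟨k, rfl⟩ := hN r
      rw [← Nat.cast_mul, ZMod.natCast_eq_zero_iff, pow_succ', ] at hr
      obtain ⟨c, rfl⟩ := Nat.dvd_of_mul_dvd_mul_left hpp.pos hr
      refine ⟨((c : ℤ) : ZMod p), ?_⟩
      rw [hl]; push_cast; ring
    qone := by
      have := hl 1
      push_cast at this ⊢
      rw [this, mul_one]
    pord := by
      intro r hr
      obtain ⟨k, rfl⟩ := hN r
      rw [map_natCast] at hr
      have h1 : (((k : ℤ) - 1 : ℤ) : ZMod p) = 0 := by push_cast; rw [hr, sub_self]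
      rw [ZMod.intCast_zmod_eq_zero_iff_dvd] at h1
      have h2 := dvd_sub_pow_of_dvd_sub h1 (m + 1)
      have h3 : ((((k : ℤ) ^ p ^ (m + 1) - 1 ^ p ^ (m + 1) : ℤ)) : ZMod (p ^ (m + 2))) = 0 := by
        rw [ZMod.intCast_zmod_eq_zero_iff_dvd]; push_cast; exact h2
      push_cast at h3
      rw [one_pow] at h3
      exact sub_eq_zero.1 h3 }

section pres
variable (p m : ℕ) [Fact p.Prime] (hodd : Odd p)

theorem rels_ok : ∀ r ∈ metacyclicRels p (m + 3),
    FreeGroup.lift (![L.X, L.Y] : Fin 2 → L (dat p m hodd)) r = 1 := by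
  intro r hr
  simp only [metacyclicRels, Set.mem_insert_iff, Set.mem_singleton_iff] at hr
  rcases hr with rfl | rfl | rfl
  · rw [map_pow, FreeGroup.lift_apply_of]
    change (L.X : L (dat p m hodd)) ^ _ = 1
    rw [L.X_pow]
    ext
    · exact ZMod.natCast_self (p ^ (m + 2))
    · rfl
  · rw [map_pow, FreeGroup.lift_apply_of]
    change (L.Y : L (dat p m hodd)) ^ _ = 1
    rw [L.Y_pow]
    ext
    · rfl
    · exact ZMod.natCast_self p
  · simp only [map_mul, map_inv, map_pow, FreeGroup.lift_apply_of]
    exact L.rel (D := dat p m hodd)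

noncomputable def toL : PresentedGroup (metacyclicRels p (m + 3)) →* L (dat p m hodd) :=
  PresentedGroup.toGroup (rels_ok p m hodd)

theorem toL_bij : Function.Bijective (toL p m hodd) := by
  let x : PresentedGroup (metacyclicRels p (m + 3)) := PresentedGroup.of 0
  let y : PresentedGroup (metacyclicRels p (m + 3)) := PresentedGroup.of 1
  have tx : toL p m hodd x = L.X := PresentedGroup.toGroup.of _
  have ty : toL p m hodd y = L.Y := PresentedGroup.toGroup.of _
  have hx : x ^ p ^ (m + 2) = 1 :=
    PresentedGroup.one_of_mem (rels := metacyclicRels p (m + 3)) (by left; rfl)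
  have hy : y ^ p = 1 :=
    PresentedGroup.one_of_mem (rels := metacyclicRels p (m + 3)) (by right; left; rfl)
  have hxy : y⁻¹ * x * y * (x ^ (1 + p ^ (m + 1)))⁻¹ = 1 :=
    PresentedGroup.one_of_mem (rels := metacyclicRels p (m + 3)) (by right; right; rfl)
  rw [mul_inv_eq_one] at hxy
  have hpp : p.Prime := Fact.out
  have comm : ∀ l : ℕ, x ^ l * y = y * x ^ ((1 + p ^ (m + 1)) * l) := by
    intro l
    rw [pow_mul, ← hxy]
    have := conj_pow (i := l) (a := y⁻¹) (b := x)
    rw [inv_inv] at this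
    rw [this]; group
  have sy : ∀ c k l : ℕ, ∃ k' l' : ℕ, y ^ k * x ^ l * y ^ c = y ^ k' * x ^ l' := by
    intro c
    induction c with
    | zero => intro k l; exact ⟨k, l, by simp⟩
    | succ c ih =>
      intro k l
      obtain ⟨k', l', h⟩ := ih (k + 1) ((1 + p ^ (m + 1)) * l)
      refine ⟨k', l', ?_⟩
      rw [← h, pow_succ', pow_succ, ← mul_assoc, mul_assoc (y ^ k), comm, ← mul_assoc]
  have yinv : y⁻¹ = y ^ (p - 1) := by
    rw [inv_eq_iff_mul_eq_one, ← pow_succ', Nat.sub_add_cancel hpp.one_lt.le, hy]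
  have xinv : x⁻¹ = x ^ (p ^ (m + 2) - 1) := by
    rw [inv_eq_iff_mul_eq_one, ← pow_succ', Nat.sub_add_cancel (Nat.pos_of_ne_zero (pow_ne_zero _ hpp.ne_zero)), hx]
  have rep : ∀ g : PresentedGroup (metacyclicRels p (m + 3)), ∃ k l : ℕ, g = y ^ k * x ^ l := by
    intro g
    have hg : g ∈ Subgroup.closure (Set.range (PresentedGroup.of (rels := metacyclicRels p (m + 3)))) := by
      rw [PresentedGroup.closure_range_of]; trivial
    induction hg using Subgroup.closure_induction_right with
    | one => exact ⟨0, 0, by simp⟩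
    | mul_right g _ z hz ih =>
      obtain ⟨k, l, rfl⟩ := ih
      obtain ⟨i, rfl⟩ := hz
      fin_cases i
      · exact ⟨k, l + 1, by rw [pow_succ, ← mul_assoc]; rfl⟩
      · obtain ⟨k', l', h⟩ := sy 1 k l
        exact ⟨k', l', by rw [← h, pow_one]; rfl⟩
    | mul_inv_cancel g _ z hz ih =>
      obtain ⟨k, l, rfl⟩ := ih
      obtain ⟨i, rfl⟩ := hz
      fin_cases i
      · refine ⟨k, l + (p ^ (m + 2) - 1), ?_⟩
        rw [pow_add, ← xinv, ← mul_assoc]; rfl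
      · obtain ⟨k', l', h⟩ := sy (p - 1) k l
        exact ⟨k', l', by rw [← h, ← yinv]; rfl⟩
  constructor
  · rw [injective_iff_map_eq_one]
    intro g hg
    obtain ⟨k, l, rfl⟩ := rep g
    rw [map_mul, map_pow, map_pow, tx, ty, L.YX_pow] at hg
    have h1 : (k : ZMod p) = 0 := congrArg L.b hg
    have h2 := congrArg L.a hg
    simp only [h1, zero_mul, mul_zero, map_zero, sub_zero, L.one_a] at h2
    rw [ZMod.natCast_eq_zero_iff] at h1 h2
    obtain ⟨k, rfl⟩ := h1
    obtain ⟨l, rfl⟩ := h2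
    rw [pow_mul, hy, pow_mul, hx]; simp
  · intro g
    obtain ⟨k, l, rfl⟩ := L.exists_rep g
    exact ⟨y ^ k * x ^ l, by rw [map_mul, map_pow, map_pow, tx, ty]⟩

end pres

end MC

/-- Let `p` be an odd prime, `n ≥ 4`, and `G` the metacyclic group of
order `p^n` presented by `⟨x, y ∣ x^(p^(n-1)), y^p, x^y = x^(1+p^(n-2))⟩`.  Let
`A := Aut G` and `Z := Z(A)`.  Then the canonical map `Aut A → Aut (A/Z)` is surjective:
every automorphism of `A/Z` lifts to an automorphism of `A`. -/
theorem canonical_map_to_aut_of_central_quotient_surjective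
    (p n : ℕ) (hp : p.Prime) (hodd : Odd p) (hn : 4 ≤ n)
    (φ : MulAut ((MulAut (PresentedGroup (metacyclicRels p n))) ⧸
      Subgroup.center (MulAut (PresentedGroup (metacyclicRels p n))))) :
    ∃ ψ : MulAut (MulAut (PresentedGroup (metacyclicRels p n))),
      ∀ a : MulAut (PresentedGroup (metacyclicRels p n)),
        ((ψ a : MulAut (PresentedGroup (metacyclicRels p n))) :
            (MulAut (PresentedGroup (metacyclicRels p n))) ⧸
              Subgroup.center (MulAut (PresentedGroup (metacyclicRels p n)))) =
          φ ((a : (MulAut (PresentedGroup (metacyclicRels p n))) ⧸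
              Subgroup.center (MulAut (PresentedGroup (metacyclicRels p n))))) := by
  have : Fact p.Prime := ⟨hp⟩
  obtain ⟨m, rfl⟩ : ∃ m, n = m + 3 := ⟨n - 3, by omega⟩
  have : NeZero (p ^ (m + 2)) := ⟨pow_ne_zero _ hp.ne_zero⟩
  exact MC.main_abs (D := MC.dat p m hodd)
    (MulEquiv.ofBijective (MC.toL p m hodd) (MC.toL_bij p m hodd)) φ
end

section
/- Let p be an odd prime, let n ≥ 4, and let G be the metacyclic group of order p^n presented by generators x, y and relations x^{p^{n-1}} = 1, y^p = 1, and y^{-1}xy = x^{1+p^{n-2}}. Then Inn(G) is not a characteristic subgroup of Aut(G): there exists an automorphism Ψ of Aut(G) such that Ψ(Inn(G)) ≠ Inn(G). -/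
namespace MetaAut

structure Dat (R F : Type) [CommRing R] [CommRing F] where
  pi : R →+* F
  io : F →+ R
  h : F
  mul_io : ∀ r k, r * io k = io (pi r * k)
  pi_io : ∀ k, pi (io k) = 0
  hh : h + h = 1

variable {R F : Type} [CommRing R] [CommRing F]

/-- The Baer-type model of the group. -/
@[ext] structure M (D : Dat R F) where
  a : R
  b : F

/-- The matrix monoid. -/
@[ext] structure E (D : Dat R F) where
  al : R
  be : F
  ga : F

variable {D : Dat R F}

instance : Mul (M D) :=
  ⟨fun u v => ⟨u.a + v.a + D.io (D.h * (D.pi u.a * v.b - u.b * D.pi v.a)), u.b + v.b⟩⟩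
instance : One (M D) := ⟨⟨0, 0⟩⟩
instance : Inv (M D) := ⟨fun u => ⟨-u.a, -u.b⟩⟩

theorem mul_a (u v : M D) :
    (u * v).a = u.a + v.a + D.io (D.h * (D.pi u.a * v.b - u.b * D.pi v.a)) := rfl
theorem mul_b (u v : M D) : (u * v).b = u.b + v.b := rfl
theorem one_a : (1 : M D).a = 0 := rfl
theorem one_b : (1 : M D).b = 0 := rfl
theorem inv_a (u : M D) : (u⁻¹).a = -u.a := rfl
theorem inv_b (u : M D) : (u⁻¹).b = -u.b := rfl

instance : Group (M D) :=
  Group.ofLeftAxioms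
    (by
      intro u v w
      ext
      · simp only [mul_a, mul_b, map_add, D.pi_io, add_zero]
        have : ∀ s t s' t' : F, s + t = s' + t' → D.io s + D.io t = D.io s' + D.io t' := by
          intro s t s' t' hs
          rw [← map_add, ← map_add, hs]
        have h2 := this (D.h * (D.pi u.a * v.b - u.b * D.pi v.a))
          (D.h * ((D.pi u.a + D.pi v.a) * w.b - (u.b + v.b) * D.pi w.a))
          (D.h * (D.pi v.a * w.b - v.b * D.pi w.a))
          (D.h * (D.pi u.a * (v.b + w.b) - u.b * (D.pi v.a + D.pi w.a))) (by ring)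
        linear_combination h2
      · simp only [mul_b]; ring)
    (by
      intro u
      ext
      · simp [mul_a, one_a, one_b]
      · simp [mul_b, one_b])
    (by
      intro u
      ext
      · simp only [mul_a, inv_a, inv_b, one_a, map_neg]
        have : D.h * (-D.pi u.a * u.b - -u.b * D.pi u.a) = 0 := by ring
        rw [this]; simp
      · simp [mul_b, inv_b, one_b])

theorem pow_ab (u : M D) (k : ℕ) : u ^ k = ⟨k * u.a, k * u.b⟩ := by
  induction k with
  | zero => ext <;> simp [one_a, one_b]
  | succ k ih =>
    rw [pow_succ, ih]
    ext
    · simp only [mul_a, map_mul, map_natCast]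
      have : D.h * (k * D.pi u.a * u.b - k * u.b * D.pi u.a) = 0 := by ring
      rw [this]; push_cast; simp; ring
    · simp only [mul_b]; push_cast; ring

instance : Mul (E D) :=
  ⟨fun s t => ⟨s.al * t.al + D.io (s.be * t.ga), D.pi s.al * t.be + s.be,
    s.ga * D.pi t.al + t.ga⟩⟩
instance : One (E D) := ⟨⟨1, 0, 0⟩⟩

theorem mul_al (s t : E D) : (s * t).al = s.al * t.al + D.io (s.be * t.ga) := rfl
theorem mul_be (s t : E D) : (s * t).be = D.pi s.al * t.be + s.be := rfl
theorem mul_ga (s t : E D) : (s * t).ga = s.ga * D.pi t.al + t.ga := rfl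
theorem one_al : (1 : E D).al = 1 := rfl
theorem one_be : (1 : E D).be = 0 := rfl
theorem one_ga : (1 : E D).ga = 0 := rfl

theorem io_mul (D : Dat R F) (r : R) (k : F) : D.io k * r = D.io (D.pi r * k) := by
  rw [mul_comm, D.mul_io]

instance : Monoid (E D) where
  mul_assoc s t w := by
    ext
    · simp only [mul_al, mul_be, mul_ga, add_mul, mul_add, io_mul, D.mul_io, map_add]
      rw [show D.pi w.al * (s.be * t.ga) = s.be * (t.ga * D.pi w.al) by ring,
        show D.pi s.al * t.be * w.ga = D.pi s.al * (t.be * w.ga) by ring]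
      ring
    · simp only [mul_al, mul_be, map_add, map_mul, D.pi_io]; ring
    · simp only [mul_al, mul_ga, map_add, map_mul, D.pi_io]; ring
  one_mul s := by
    ext <;> simp [mul_al, mul_be, mul_ga, one_al, one_be, one_ga]
  mul_one s := by
    ext <;> simp [mul_al, mul_be, mul_ga, one_al, one_be, one_ga]

/-- transpose -/
def tr (s : E D) : E D := ⟨s.al, s.ga, s.be⟩

theorem tr_mul (s t : E D) : tr (s * t) = tr t * tr s := by
  ext
  · simp only [tr, mul_al]; rw [mul_comm s.al, mul_comm s.be]
  · simp only [tr, mul_be, mul_ga]; ring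
  · simp only [tr, mul_be, mul_ga]; ring

theorem tr_one : tr (1 : E D) = 1 := rfl
theorem tr_tr (s : E D) : tr (tr s) = s := rfl

/-- inverse transpose -/
def psiE (D : Dat R F) : (E D)ˣ ≃* (E D)ˣ where
  toFun u := ⟨tr u.inv, tr u.val, by rw [← tr_mul, u.val_inv, tr_one],
    by rw [← tr_mul, u.inv_val, tr_one]⟩
  invFun u := ⟨tr u.inv, tr u.val, by rw [← tr_mul, u.val_inv, tr_one],
    by rw [← tr_mul, u.inv_val, tr_one]⟩
  left_inv u := by ext1; rfl
  right_inv u := by ext1; rfl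
  map_mul' u v := by
    ext1
    change tr ((u * v)⁻¹).val = tr (u⁻¹).val * tr (v⁻¹).val
    rw [mul_inv_rev, Units.val_mul, tr_mul]

/-- action of a matrix -/
def act (s : E D) : M D →* M D where
  toFun u := ⟨s.al * u.a + D.io (s.be * u.b), s.ga * D.pi u.a + u.b⟩
  map_one' := by ext <;> simp [one_a, one_b]
  map_mul' u v := by
    ext
    · simp only [mul_a, mul_b, mul_add, map_add, map_mul, D.pi_io, D.mul_io, add_zero]
      rw [show D.pi s.al * (D.h * (D.pi u.a * v.b - u.b * D.pi v.a)) =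
        D.h * (D.pi s.al * D.pi u.a * (s.ga * D.pi v.a + v.b) -
          (s.ga * D.pi u.a + u.b) * (D.pi s.al * D.pi v.a)) by ring]
      ring
    · simp only [mul_a, mul_b, map_add, D.pi_io]; ring

theorem act_a (s : E D) (u : M D) : (act s u).a = s.al * u.a + D.io (s.be * u.b) := rfl
theorem act_b (s : E D) (u : M D) : (act s u).b = s.ga * D.pi u.a + u.b := rfl

theorem act_mul (s t : E D) (u : M D) : act (s * t) u = act s (act t u) := by
  ext
  · simp only [act_a, act_b, mul_al, mul_be, mul_add, add_mul, io_mul, D.mul_io, map_add]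
    rw [show D.pi u.a * (s.be * t.ga) = s.be * (t.ga * D.pi u.a) by ring,
      show D.pi s.al * t.be * u.b = D.pi s.al * (t.be * u.b) by ring]
    ring
  · simp only [act_a, act_b, mul_al, mul_ga, map_add, map_mul, D.pi_io]; ring

theorem act_one (u : M D) : act 1 u = u := by
  ext <;> simp [act_a, act_b, one_al, one_be, one_ga]

def X (D : Dat R F) : M D := ⟨1, 0⟩
def Y (D : Dat R F) : M D := ⟨0, 1⟩

theorem act_inj (hio : Function.Injective D.io) (s t : E D) (hst : ∀ u, act s u = act t u) :
    s = t := by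
  have h1 := hst (X D)
  have h2 := hst (Y D)
  ext
  · simpa [X, act_a] using congrArg M.a h1
  · apply hio; simpa [Y, act_a] using congrArg M.a h2
  · simpa [X, act_b] using congrArg M.b h1

def actU (D : Dat R F) : (E D)ˣ →* MulAut (M D) where
  toFun u :=
    { toFun := act u.val
      invFun := act u.inv
      left_inv := fun w => by rw [← act_mul, u.inv_val, act_one]
      right_inv := fun w => by rw [← act_mul, u.val_inv, act_one]
      map_mul' := map_mul _ }
  map_one' := by ext1 w; exact act_one w
  map_mul' u v := by ext1 w; exact act_mul _ _ w

theorem actU_apply (u : (E D)ˣ) (w : M D) : actU D u w = act u.val w := rfl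

theorem actU_bij (hio : Function.Injective D.io)
    (hs : ∀ φ : MulAut (M D), ∃ s : E D, ∀ w, φ w = act s w) :
    Function.Bijective (actU D) := by
  constructor
  · intro u v huv
    ext1
    apply act_inj hio
    intro w
    exact DFunLike.congr_fun huv w
  · intro φ
    obtain ⟨s, h1⟩ := hs φ
    obtain ⟨t, h2⟩ := hs φ⁻¹
    refine ⟨⟨s, t, ?_, ?_⟩, ?_⟩
    · apply act_inj hio
      intro w
      rw [act_mul, ← h2, ← h1, act_one]; simp
    · apply act_inj hio
      intro w
      rw [act_mul, ← h1, ← h2, act_one]; simp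
    · ext1 w
      exact (h1 w).symm

/-- the key unit -/
def u0 (D : Dat R F) : (E D)ˣ :=
  ⟨⟨1, 1, 0⟩, ⟨1, -1, 0⟩, by ext <;> simp [mul_al, mul_be, mul_ga, one_al, one_be, one_ga],
    by ext <;> simp [mul_al, mul_be, mul_ga, one_al, one_be, one_ga]⟩

theorem conj_b (m w : M D) : (MulAut.conj m w).b = w.b := by
  simp [MulAut.conj_apply, mul_b, inv_b]

theorem conj_X : MulAut.conj (X D) = actU D (u0 D) := by
  ext w
  · rw [MulAut.conj_apply, actU_apply]
    simp only [mul_a, mul_b, inv_a, inv_b, act_a, act_b, u0, X, map_add, D.pi_io]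
    have : w.b = D.h * w.b + D.h * w.b := by rw [← add_mul, D.hh, one_mul]
    simp
    nth_rewrite 3 [this]
    rw [map_add]; ring
  · rw [conj_b, actU_apply]
    simp [act_b, u0]

theorem abstract_main [Nontrivial F] {P : Type} [Group P] (e : P ≃* M D)
    (hio : Function.Injective D.io)
    (hs : ∀ φ : MulAut (M D), ∃ s : E D, ∀ w, φ w = act s w) :
    ∃ Ψ : MulAut (MulAut P), Subgroup.map Ψ.toMonoidHom (MulAut.conj (G := P)).range ≠
        (MulAut.conj (G := P)).range := by
  let A : (E D)ˣ ≃* MulAut (M D) := MulEquiv.ofBijective (actU D) (actU_bij hio hs)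
  have hA : ∀ u, A u = actU D u := fun u => rfl
  let Θ : MulAut P ≃* (E D)ˣ := (MulAut.congr e).trans A.symm
  have hΘ : ∀ g, A (Θ (MulAut.conj g)) = MulAut.conj (e g) := by
    intro g
    have : A (Θ (MulAut.conj g)) = MulAut.congr e (MulAut.conj g) := by simp [Θ]
    rw [this]
    ext1 w
    simp [MulAut.congr]
  refine ⟨(Θ.trans (psiE D)).trans Θ.symm, fun heq => ?_⟩
  have hm : ((Θ.trans (psiE D)).trans Θ.symm) (MulAut.conj (e.symm (X D))) ∈
      (MulAut.conj (G := P)).range := by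
    rw [← heq]
    exact ⟨_, ⟨_, rfl⟩, rfl⟩
  obtain ⟨g, hg⟩ := hm
  have h1 : Θ (MulAut.conj (e.symm (X D))) = u0 D := by
    apply A.injective
    rw [hΘ, hA, e.apply_symm_apply, conj_X]
  have h2 : Θ (MulAut.conj g) = psiE D (u0 D) := by
    rw [hg]
    simp [h1]
  have h3 := hΘ g
  rw [h2, hA] at h3
  have h4 := congrArg M.b (DFunLike.congr_fun h3 (X D))
  rw [conj_b, actU_apply, act_b] at h4
  simp [psiE, u0, tr, X] at h4

theorem classify {p q : ℕ} [IsDomain F] (hpF : (p : F) = 0)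
    (hqF : (q : F) = 0) (hqR : D.io 1 = q) (hio : Function.Injective D.io)
    (htor : ∀ r : R, (p : R) * r = 0 → ∃ k, r = D.io k)
    (hgen : ∀ w : M D, ∃ k l : ℕ, w = X D ^ k * Y D ^ l)
    (φ : MulAut (M D)) : ∃ s : E D, ∀ w, φ w = act s w := by
  have hpR : (p : R) * 0 = 0 := by simp
  have hpio : ∀ k, (p : R) * D.io k = 0 := by
    intro k; rw [D.mul_io]; simp [hpF]
  have hYp : Y D ^ p = 1 := by
    rw [pow_ab]; ext <;> simp [Y, one_a, one_b, hpF]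
  have hq : ∀ r : R, (q : R) * r = D.io (D.pi r) := by
    intro r; rw [← hqR, io_mul, mul_one]
  have hXY : X D * Y D = Y D * X D ^ (1 + q) := by
    rw [pow_ab]
    ext
    · simp only [mul_a, X, Y]
      have : D.io 1 = D.io D.h + D.io D.h := by rw [← map_add, D.hh]
      simp [hqF, ← hqR, D.pi_io]
      linear_combination -this
    · simp [mul_b, X, Y]
  have hY' : φ (Y D) ^ p = 1 := by rw [← map_pow, hYp, map_one]
  obtain ⟨be, hbe⟩ : ∃ k, (φ (Y D)).a = D.io k := by
    apply htor
    rw [pow_ab] at hY'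
    exact congrArg M.a hY'
  have hne : D.pi (φ (X D)).a ≠ 0 := by
    intro h0
    have : φ (X D ^ q) = 1 := by
      rw [map_pow, pow_ab]
      ext
      · simp [hq, h0, one_a]
      · simp [hqF, one_b]
    rw [map_eq_one_iff φ φ.injective, pow_ab] at this
    have h1 := congrArg M.a this
    simp only [X, mul_one, one_a] at h1
    rw [← hqR] at h1
    have := hio (h1.trans (map_zero _).symm)
    exact one_ne_zero this
  have hb : (φ (Y D)).b = 1 := by
    have h1 := congrArg φ hXY
    rw [map_mul, map_mul, map_pow, pow_ab] at h1
    have h2 := congrArg M.a h1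
    simp only [mul_a, hbe, map_mul, D.pi_io] at h2
    push_cast at h2
    rw [add_mul, hq] at h2
    simp only [map_add, map_one, map_natCast, hqF, D.pi_io] at h2
    set al := (φ (X D)).a
    set de := (φ (Y D)).b
    have h3 : D.io (D.h * (D.pi al * de)) + D.io (D.h * (D.pi al * de)) = D.io (D.pi al) := by
      simp only [mul_zero, sub_zero, zero_mul, zero_sub, add_zero, one_mul, mul_neg, map_neg] at h2
      rw [mul_comm de] at h2
      linear_combination h2
    rw [← map_add, ← add_mul, D.hh, one_mul] at h3
    have h4 := hio h3
    exact mul_left_cancel₀ hne (by rw [h4, mul_one])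
  refine ⟨⟨(φ (X D)).a, be, (φ (X D)).b⟩, fun w => ?_⟩
  obtain ⟨k, l, rfl⟩ := hgen w
  have e1 : φ (X D) = act ⟨(φ (X D)).a, be, (φ (X D)).b⟩ (X D) := by
    ext <;> simp [act_a, act_b, X]
  have e2 : φ (Y D) = act ⟨(φ (X D)).a, be, (φ (X D)).b⟩ (Y D) := by
    ext
    · rw [hbe]; simp [act_a, Y]
    · rw [hb]; simp [act_b, Y]
  rw [map_mul, map_mul, map_pow, map_pow, map_pow, map_pow, ← e1, ← e2]

theorem gen (hR : Function.Surjective (Nat.cast : ℕ → R))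
    (hF : Function.Surjective (Nat.cast : ℕ → F)) (w : M D) :
    ∃ k l : ℕ, w = X D ^ k * Y D ^ l := by
  obtain ⟨l, hl⟩ := hF w.b
  obtain ⟨k, hk⟩ := hR (w.a - D.io (D.h * (D.pi w.a * w.b)))
  refine ⟨k, l, ?_⟩
  rw [pow_ab, pow_ab]
  ext
  · simp only [mul_a, X, Y, hl, hk, mul_one, mul_zero]
    simp [D.pi_io]
  · simp [mul_b, X, Y, hl]

section concrete
variable (p m : ℕ)

/-- multiplication by `p^(m+2)`. -/
def ioZ : ZMod p →+ ZMod (p ^ (m + 3)) :=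
  ZMod.lift p ⟨(AddMonoidHom.mulLeft ((p : ZMod (p ^ (m + 3))) ^ (m + 2))).comp
    (Int.castAddHom _), by
      have : ((p ^ (m + 3) : ℕ) : ZMod (p ^ (m + 3))) = 0 := ZMod.natCast_self _
      push_cast at this
      simp [← pow_succ, this]⟩

theorem ioZ_int (k : ℤ) : ioZ p m (k : ZMod p) = (p : ZMod (p ^ (m + 3))) ^ (m + 2) * k := by
  simp [ioZ]

theorem dvdp : p ∣ p ^ (m + 3) := dvd_pow_self p (by omega)

def datZ (hodd : Odd p) : Dat (ZMod (p ^ (m + 3))) (ZMod p) where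
  pi := ZMod.castHom (dvdp p m) _
  io := ioZ p m
  h := (((p + 1) / 2 : ℕ) : ZMod p)
  mul_io r k := by
    obtain ⟨r, rfl⟩ := ZMod.intCast_surjective r
    obtain ⟨k, rfl⟩ := ZMod.intCast_surjective k
    rw [map_intCast (ZMod.castHom (dvdp p m) (ZMod p)), ← Int.cast_mul, ioZ_int, ioZ_int]
    push_cast; ring
  pi_io k := by
    obtain ⟨k, rfl⟩ := ZMod.intCast_surjective k
    rw [ioZ_int, map_mul, map_pow, map_natCast]
    simp
  hh := by
    obtain ⟨t, rfl⟩ := hodd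
    rw [← Nat.cast_add, show (2 * t + 1 + 1) / 2 + (2 * t + 1 + 1) / 2 = (2 * t + 1) + 1 by omega,
      Nat.cast_add, ZMod.natCast_self]
    simp

end concrete

theorem concrete_main (p m : ℕ) (hp : p.Prime) (hodd : Odd p) :
    ∃ Ψ : MulAut (MulAut (PresentedGroup (metacyclicRels p (m + 4)))),
      Subgroup.map Ψ.toMonoidHom
          (MulAut.conj (G := PresentedGroup (metacyclicRels p (m + 4)))).range ≠
        (MulAut.conj (G := PresentedGroup (metacyclicRels p (m + 4)))).range := by
  haveI : Fact p.Prime := ⟨hp⟩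
  haveI : NeZero (p ^ (m + 3)) := ⟨pow_ne_zero _ hp.ne_zero⟩
  set D := datZ p m hodd with hD
  have hio_def : D.io = ioZ p m := rfl
  have hqR : D.io 1 = ((p ^ (m + 2) : ℕ) : ZMod (p ^ (m + 3))) := by
    have := ioZ_int p m 1
    push_cast at this ⊢
    rw [hio_def, this, mul_one]
  have hpF : (p : ZMod p) = 0 := ZMod.natCast_self p
  have hqF : ((p ^ (m + 2) : ℕ) : ZMod p) = 0 := by push_cast; rw [hpF]; simp
  have hp0 : (p : ℤ) ≠ 0 := by exact_mod_cast hp.ne_zero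
  have hio : Function.Injective D.io := by
    rw [injective_iff_map_eq_zero]
    intro k hk
    obtain ⟨k, rfl⟩ := ZMod.intCast_surjective k
    rw [hio_def, ioZ_int] at hk
    have h1 : (((p : ℤ) ^ (m + 2) * k : ℤ) : ZMod (p ^ (m + 3))) = 0 := by push_cast; exact hk
    rw [ZMod.intCast_zmod_eq_zero_iff_dvd] at h1 ⊢
    push_cast at h1
    rw [pow_succ _ (m + 2)] at h1
    exact (mul_dvd_mul_iff_left (pow_ne_zero _ hp0)).1 h1
  have htor : ∀ r : ZMod (p ^ (m + 3)), (p : ZMod (p ^ (m + 3))) * r = 0 → ∃ k, r = D.io k := by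
    intro r hr
    obtain ⟨r, rfl⟩ := ZMod.intCast_surjective r
    have h1 : (((p : ℤ) * r : ℤ) : ZMod (p ^ (m + 3))) = 0 := by push_cast; exact hr
    rw [ZMod.intCast_zmod_eq_zero_iff_dvd] at h1
    push_cast at h1
    rw [pow_succ' _ (m + 2)] at h1
    obtain ⟨k, rfl⟩ := (mul_dvd_mul_iff_left hp0).1 h1
    exact ⟨k, by rw [hio_def, ioZ_int]; push_cast; rfl⟩
  have hgen : ∀ w : M D, ∃ k l : ℕ, w = X D ^ k * Y D ^ l :=
    gen (ZMod.natCast_zmod_surjective) (ZMod.natCast_zmod_surjective)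
  have hXY : X D * Y D = Y D * X D ^ (1 + p ^ (m + 2)) := by
    rw [pow_ab]
    ext
    · simp only [mul_a, X, Y]
      have : D.io 1 = D.io D.h + D.io D.h := by rw [← map_add, D.hh]
      rw [Nat.cast_add, ← hqR]
      simp [D.pi_io]
      linear_combination -this
    · simp [mul_b, X, Y]
  let f0 : Fin 2 → M D := ![X D, Y D]
  have hrel : ∀ r ∈ metacyclicRels p (m + 4), FreeGroup.lift f0 r = 1 := by
    intro r hr
    rcases hr with rfl | rfl | rfl
    · simp only [map_pow, FreeGroup.lift_apply_of, f0, Matrix.cons_val_zero]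
      rw [pow_ab]
      have : ((p ^ (m + 3) : ℕ) : ZMod (p ^ (m + 3))) = 0 := ZMod.natCast_self _
      ext
      · simp only [X, mul_one, one_a]; exact this
      · simp [X, one_b]
    · simp only [map_pow, FreeGroup.lift_apply_of, f0]
      rw [pow_ab]
      ext <;> simp [Y, one_a, one_b]
    · simp only [map_mul, map_inv, map_pow, FreeGroup.lift_apply_of, f0]
      simp only [Matrix.cons_val_zero, Matrix.cons_val_one]
      rw [mul_inv_eq_one, mul_assoc, inv_mul_eq_iff_eq_mul]
      exact hXY
  let f : PresentedGroup (metacyclicRels p (m + 4)) →* M D := PresentedGroup.toGroup hrel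
  let x : PresentedGroup (metacyclicRels p (m + 4)) := PresentedGroup.of 0
  let y : PresentedGroup (metacyclicRels p (m + 4)) := PresentedGroup.of 1
  have hfx : f x = X D := PresentedGroup.toGroup.of hrel
  have hfy : f y = Y D := PresentedGroup.toGroup.of hrel
  have rx : x ^ p ^ (m + 3) = 1 :=
    PresentedGroup.one_of_mem (rels := metacyclicRels p (m + 4)) (Or.inl rfl)
  have ry : y ^ p = 1 :=
    PresentedGroup.one_of_mem (rels := metacyclicRels p (m + 4)) (Or.inr (Or.inl rfl))
  have rxy : y⁻¹ * x * y * (x ^ (1 + p ^ (m + 2)))⁻¹ = 1 :=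
    PresentedGroup.one_of_mem (rels := metacyclicRels p (m + 4)) (Or.inr (Or.inr rfl))
  have rxy' : ∀ i : ℤ, x ^ i * y = y * x ^ ((1 + p ^ (m + 2) : ℕ) * i) := by
    intro i
    rw [mul_inv_eq_one] at rxy
    rw [zpow_mul, zpow_natCast, ← rxy]
    have : y⁻¹ * x * y = y⁻¹ * x * y⁻¹⁻¹ := by simp
    rw [this, conj_zpow]; group
  have rxyj : ∀ (j : ℕ) (i : ℤ), ∃ i' : ℤ, x ^ i * y ^ j = y ^ j * x ^ i' := by
    intro j
    induction j with
    | zero => intro i; exact ⟨i, by simp⟩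
    | succ j ih =>
      intro i
      obtain ⟨i', hi'⟩ := ih i
      exact ⟨_, by rw [pow_succ, ← mul_assoc, hi', mul_assoc, rxy', ← mul_assoc]⟩
  have hnf : ∀ g : PresentedGroup (metacyclicRels p (m + 4)), ∃ (j : ℕ) (i : ℤ),
      g = y ^ j * x ^ i := by
    intro g
    have hg : g ∈ Subgroup.closure (Set.range
        (PresentedGroup.of (rels := metacyclicRels p (m + 4)))) := by
      rw [PresentedGroup.closure_range_of]; trivial
    induction hg using Subgroup.closure_induction_left with
    | one => exact ⟨0, 0, by simp⟩
    | mul_left s hs g _ ih =>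
      obtain ⟨j, i, rfl⟩ := ih
      obtain ⟨t, rfl⟩ := hs
      fin_cases t
      · obtain ⟨i', hi'⟩ := rxyj j 1
        refine ⟨j, i' + i, ?_⟩
        change x * _ = _
        rw [zpow_one] at hi'
        rw [← mul_assoc, hi', zpow_add, mul_assoc]
      · refine ⟨j + 1, i, ?_⟩
        change y * _ = _
        rw [pow_succ', mul_assoc]
    | inv_mul_cancel s hs g _ ih =>
      obtain ⟨j, i, rfl⟩ := ih
      obtain ⟨t, rfl⟩ := hs
      fin_cases t
      · obtain ⟨i', hi'⟩ := rxyj j (-1)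
        refine ⟨j, i' + i, ?_⟩
        change x⁻¹ * _ = _
        rw [zpow_neg_one] at hi'
        rw [← mul_assoc, hi', zpow_add, mul_assoc]
      · refine ⟨(p - 1) + j, i, ?_⟩
        change y⁻¹ * _ = _
        have : y⁻¹ = y ^ (p - 1) := by
          rw [inv_eq_iff_mul_eq_one, ← pow_succ', Nat.sub_add_cancel hp.one_lt.le, ry]
        rw [this, pow_add, mul_assoc]
  have hinj : Function.Injective f := by
    rw [injective_iff_map_eq_one]
    intro g hg
    obtain ⟨j, i, rfl⟩ := hnf g
    -- replace the integer exponent by a natural one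
    obtain ⟨i, hi⟩ : ∃ k : ℕ, x ^ i = x ^ k := by
      refine ⟨(i % (p ^ (m + 3) : ℕ)).toNat, ?_⟩
      rw [← zpow_natCast, Int.toNat_of_nonneg (Int.emod_nonneg _ (by
        exact_mod_cast (NeZero.ne (p ^ (m + 3)))))]
      conv_lhs => rw [← Int.emod_add_mul_ediv i (p ^ (m + 3) : ℕ)]
      rw [zpow_add, zpow_mul, zpow_natCast, rx]; simp
    rw [hi] at hg ⊢
    rw [map_mul, map_pow, map_pow, hfx, hfy, pow_ab, pow_ab] at hg
    have h1 := congrArg M.b hg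
    simp only [mul_b, one_b, X, Y, mul_one, mul_zero, add_zero] at h1
    have h2 := congrArg M.a hg
    simp only [mul_a, one_a, X, Y, mul_one, mul_zero, h1] at h2
    simp at h2
    rw [ZMod.natCast_eq_zero_iff] at h1
    have h3 : ((i : ℕ) : ZMod (p ^ (m + 3))) = 0 := by simpa using h2
    rw [ZMod.natCast_eq_zero_iff] at h3
    obtain ⟨c, rfl⟩ := h1
    obtain ⟨d, rfl⟩ := h3
    rw [pow_mul, pow_mul, rx, ry]; simp
  have hsurj : Function.Surjective f := by
    intro w
    obtain ⟨k, l, rfl⟩ := hgen w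
    exact ⟨x ^ k * y ^ l, by rw [map_mul, map_pow, map_pow, hfx, hfy]⟩
  exact abstract_main (MulEquiv.ofBijective f ⟨hinj, hsurj⟩) hio
    (classify (p := p) (q := p ^ (m + 2)) hpF hqF hqR hio htor hgen)

end MetaAut

theorem inn_not_characteristic_in_aut
    (p n : ℕ) (hp : p.Prime) (hodd : Odd p) (hn : 4 ≤ n) :
    ∃ Ψ : MulAut (MulAut (PresentedGroup (metacyclicRels p n))),
      Subgroup.map Ψ.toMonoidHom
          (MulAut.conj (G := PresentedGroup (metacyclicRels p n))).range ≠
        (MulAut.conj (G := PresentedGroup (metacyclicRels p n))).range := by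
  obtain ⟨m, rfl⟩ := Nat.exists_eq_add_of_le' hn
  exact MetaAut.concrete_main p m hp hodd
end
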